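/- Let b > 1/2 and s₁, s₂ ∈ ℝ with s₁ ≤ 2, s₂ ≤ 2, and s₁+s₂ ≥ 2. Then there exists a constant C > 0 such that for all spatial indices i, j ∈ {1,2,3} and all Schwartz functions u, v on ℝ^{1+3}, ‖Q_{ij}(u,v)‖_{L²_t Ḣ^{s₁+s₂−3}_x} ≤ C‖u‖_{H^{s₁,b}}‖v‖_{H^{s₂,b}}. -/

import Mathlib

/-!
STATEMENT 3: Null form estimate of Masmoudi–Nakanishi / Foschi–Klainerman type:
`‖Q_{ij}(u,v)‖_{L²_t Ḣ^{s₁+s₂−3}_x} ≲ ‖u‖_{H^{s₁,b}} ‖v‖_{H^{s₂,b}}`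
for `b > 1/2`, `s₁, s₂ ≤ 2 ≤ s₁ + s₂`.
-/

open MeasureTheory
open scoped FourierTransform

noncomputable section

/-- The spatial part of a spacetime point/frequency `ζ = (τ, ξ) ∈ ℝ^{1+3}`. -/
def spacePart (ζ : EuclideanSpace ℝ (Fin 4)) : EuclideanSpace ℝ (Fin 3) :=
  (WithLp.equiv 2 (Fin 3 → ℝ)).symm fun i => ζ i.succ

/-- The wave-Sobolev norm `‖u‖_{H^{s,b}} = ‖⟨ξ⟩^s ⟨|τ|−|ξ|⟩^b û(τ,ξ)‖_{L²_{τ,ξ}}`. -/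
def waveSobolevNorm (s b : ℝ) (u : EuclideanSpace ℝ (Fin 4) → ℂ) : ℝ :=
  (∫ ζ : EuclideanSpace ℝ (Fin 4),
      (1 + ‖spacePart ζ‖ ^ 2) ^ s * (1 + (|ζ 0| - ‖spacePart ζ‖) ^ 2) ^ b *
        ‖𝓕 u ζ‖ ^ 2) ^ (1 / 2 : ℝ)

/-- Partial derivative of a function on `ℝ^{1+3}` in the `i`-th coordinate direction
(`i = 0` is the time direction `∂_t`). -/
def pderiv (i : Fin 4) (u : EuclideanSpace ℝ (Fin 4) → ℂ) (z : EuclideanSpace ℝ (Fin 4)) : ℂ :=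
  fderiv ℝ u z (EuclideanSpace.single i 1)

/-- The classical null form `Q_{ij}(u,v) = ∂_i u ∂_j v − ∂_j u ∂_i v` for spatial
indices `i, j ∈ {1,2,3}` (encoded as `Fin 3`, with spacetime index `i.succ`). -/
def nullFormQij (i j : Fin 3) (u v : EuclideanSpace ℝ (Fin 4) → ℂ)
    (z : EuclideanSpace ℝ (Fin 4)) : ℂ :=
  pderiv i.succ u z * pderiv j.succ v z - pderiv j.succ u z * pderiv i.succ v z

/-- The time slice `x ↦ F(t, x)` of a function on `ℝ^{1+3}`. -/
def timeSlice (F : EuclideanSpace ℝ (Fin 4) → ℂ) (t : ℝ) :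
    EuclideanSpace ℝ (Fin 3) → ℂ :=
  fun x => F ((WithLp.equiv 2 (Fin 4 → ℝ)).symm (Fin.cons t (WithLp.equiv 2 (Fin 3 → ℝ) x)))

/-- The homogeneous Sobolev norm `‖f‖_{Ḣ^σ(ℝ³)} = ‖|ξ|^σ 𝓕f(ξ)‖_{L²(ℝ³)}`. -/
def homSobolevNorm3 (σ : ℝ) (f : EuclideanSpace ℝ (Fin 3) → ℂ) : ℝ :=
  (∫ ξ : EuclideanSpace ℝ (Fin 3), ‖ξ‖ ^ (2 * σ) * ‖𝓕 f ξ‖ ^ 2) ^ (1 / 2 : ℝ)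

/-- The mixed norm `‖F‖_{L²_t Ḣ^σ_x} = (∫_ℝ ‖F(t,·)‖²_{Ḣ^σ(ℝ³)} dt)^{1/2}`. -/
def mixedL2HomNorm (σ : ℝ) (F : EuclideanSpace ℝ (Fin 4) → ℂ) : ℝ :=
  (∫ t : ℝ, homSobolevNorm3 σ (timeSlice F t) ^ 2) ^ (1 / 2 : ℝ)

open MeasureTheory
open scoped FourierTransform ENNReal
noncomputable section

lemma nf_oneD {s : Set ℝ} (hs : MeasurableSet s) {f f' : ℝ → ℝ}
    (hf' : ∀ x ∈ s, HasDerivAt f (f' x) x) (hinj : Set.InjOn f s) (w : ℝ → ℝ≥0∞) (τ : ℝ)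
    (m : ℝ → ℝ≥0∞) (C : ℝ≥0∞) (hC : C ≠ ⊤)
    (hm : ∀ x ∈ s, m x ≤ C * ENNReal.ofReal |f' x|) :
    ∫⁻ x in s, m x * w (τ - f x) ≤ C * ∫⁻ y, w y := by
  calc ∫⁻ x in s, m x * w (τ - f x)
      ≤ ∫⁻ x in s, C * (ENNReal.ofReal |f' x| * w (τ - f x)) := by
        refine setLIntegral_mono' hs fun x hx => ?_
        rw [← mul_assoc]
        exact mul_le_mul_left (hm x hx) _
    _ = C * ∫⁻ x in s, ENNReal.ofReal |f' x| * w (τ - f x) := lintegral_const_mul' _ _ hC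
    _ = C * ∫⁻ y in f '' s, w (τ - y) := by
        rw [lintegral_image_eq_lintegral_abs_deriv_mul hs
          (fun x hx => (hf' x hx).hasDerivWithinAt) hinj (fun y => w (τ - y))]
    _ ≤ C * ∫⁻ y, w (τ - y) := by
        gcongr
        exact Measure.restrict_le_self
    _ = C * ∫⁻ y, w y := by
        rw [lintegral_sub_left_eq_self w τ]

lemma nf_spherical (h : EuclideanSpace ℝ (Fin 3) → ℝ≥0∞) (hh : Measurable h) (B : ℝ≥0∞)
    (hB : ∀ ω : EuclideanSpace ℝ (Fin 3), ‖ω‖ = 1 →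
      ∫⁻ r in Set.Ioi (0 : ℝ), ENNReal.ofReal (r ^ 2) * h (r • ω) ≤ B) :
    ∫⁻ η, h η ≤ B * (volume : Measure (EuclideanSpace ℝ (Fin 3))).toSphere Set.univ := by
  set μ := (volume : Measure (EuclideanSpace ℝ (Fin 3)))
  have hmp := μ.measurePreserving_homeomorphUnitSphereProd
  have hfr : Module.finrank ℝ (EuclideanSpace ℝ (Fin 3)) - 1 = 2 := by simp
  rw [hfr] at hmp
  have e1 : ∫⁻ η, h η = ∫⁻ x : ({0}ᶜ : Set (EuclideanSpace ℝ (Fin 3))), h x ∂(μ.comap (↑)) := by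
    rw [lintegral_subtype_comap (measurableSet_singleton _).compl]
    rw [← setLIntegral_univ]
    refine setLIntegral_congr ?_
    exact (MeasureTheory.ae_eq_univ.2 (by simp)).symm
  have e2 : ∫⁻ x : ({0}ᶜ : Set (EuclideanSpace ℝ (Fin 3))), h x ∂(μ.comap (↑)) =
      ∫⁻ p : (Metric.sphere (0 : EuclideanSpace ℝ (Fin 3)) 1) × (Set.Ioi (0 : ℝ)),
        h (p.2.1 • p.1.1) ∂(μ.toSphere.prod (Measure.volumeIoiPow 2)) := by
    rw [← hmp.lintegral_comp_emb (Homeomorph.measurableEmbedding _)]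
    refine lintegral_congr fun x => ?_
    congr 1
    have := (homeomorphUnitSphereProd (EuclideanSpace ℝ (Fin 3))).symm_apply_apply x
    conv_lhs => rw [← this]
    have hx : ‖x.1‖ ≠ 0 := norm_ne_zero_iff.2 x.2
    simp [smul_smul, mul_inv_cancel₀ hx]
  rw [e1, e2, lintegral_prod]
  · calc _ ≤ ∫⁻ ω : (Metric.sphere (0 : EuclideanSpace ℝ (Fin 3)) 1), B ∂μ.toSphere := by
          refine lintegral_mono fun ω => ?_
          refine le_trans (le_of_eq ?_) (hB ω.1 (by simp))
          rw [Measure.volumeIoiPow, lintegral_withDensity_eq_lintegral_mul]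
          · rw [← lintegral_subtype_comap measurableSet_Ioi]
            rfl
          · fun_prop
          · fun_prop
      _ = _ := by rw [lintegral_const]
  · fun_prop

lemma nf_rho_eq (ξ ω : EuclideanSpace ℝ (Fin 3)) (hω : ‖ω‖ = 1) (r : ℝ) :
    ‖ξ - r • ω‖ = √((r - inner ℝ ω ξ) ^ 2 + (‖ξ‖ ^ 2 - inner ℝ ω ξ ^ 2)) := by
  have h : ‖ξ - r • ω‖ ^ 2 = (r - inner ℝ ω ξ) ^ 2 + (‖ξ‖ ^ 2 - inner ℝ ω ξ ^ 2) := by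
    rw [@norm_sub_sq_real, norm_smul, inner_smul_right, hω, real_inner_comm, mul_one,
      Real.norm_eq_abs, sq_abs]
    ring
  rw [← h, Real.sqrt_sq (norm_nonneg _)]

lemma nf_rho_deriv (a S : ℝ) (r : ℝ) (h : 0 < (r - a) ^ 2 + S) :
    HasDerivAt (fun r : ℝ => √((r - a) ^ 2 + S)) ((r - a) / √((r - a) ^ 2 + S)) r := by
  have h1 : HasDerivAt (fun r : ℝ => (r - a) ^ 2 + S) (2 * (r - a)) r := by
    have := (((hasDerivAt_id r).sub_const a).pow 2).add_const S
    simpa using this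
  have := h1.sqrt h.ne'
  convert this using 1
  field_simp

lemma nf_B_aux (a S : ℝ) (hS : 0 < S) (ε : ℝ) (hε : ε = 1 ∨ ε = -1) (r : ℝ) :
    S / (2 * ((r - a) ^ 2 + S)) ≤ 1 + ε * ((r - a) / √((r - a) ^ 2 + S)) := by
  have hq : 0 < (r - a) ^ 2 + S := by positivity
  set ρ := √((r - a) ^ 2 + S) with hρ
  have hρ0 : 0 < ρ := Real.sqrt_pos.2 hq
  have hρ2 : ρ ^ 2 = (r - a) ^ 2 + S := Real.sq_sqrt hq.le
  rw [← hρ2]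
  set c := (r - a) / ρ with hc
  have hc2 : S / (2 * ρ ^ 2) = (1 - c ^ 2) / 2 := by
    rw [hc]; field_simp; linarith
  rw [hc2]
  rcases hε with rfl | rfl <;> nlinarith [sq_nonneg (1 + c), sq_nonneg (1 - c)]

lemma nf_B1 (a S X : ℝ) (hS : 0 ≤ S) (hX : 0 < X) (ε : ℝ) (hε : ε = 1 ∨ ε = -1)
    (w : ℝ → ℝ≥0∞) (τ : ℝ) (m : ℝ → ℝ≥0∞)
    (hm : ∀ r : ℝ, 0 < r → m r ≤ ENNReal.ofReal (S / X ^ 2))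
    (hm0 : ∀ r : ℝ, 0 < r → 2 * X < √((r - a) ^ 2 + S) → m r = 0) :
    ∫⁻ r in Set.Ioi (0 : ℝ), m r * w (τ - (r + ε * √((r - a) ^ 2 + S))) ≤ 8 * ∫⁻ y, w y := by
  rcases hS.eq_or_lt with rfl | hS
  · rw [setLIntegral_congr_fun (g := fun _ => 0) measurableSet_Ioi]
    · simp
    · intro r hr
      have := hm r hr
      simp at this
      simp [this]
  · have hd : ∀ r : ℝ, HasDerivAt (fun r : ℝ => r + ε * √((r - a) ^ 2 + S))
        (1 + ε * ((r - a) / √((r - a) ^ 2 + S))) r := fun r =>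
      (hasDerivAt_id r).add ((nf_rho_deriv a S r (by positivity)).const_mul ε)
    have hpos : ∀ r : ℝ, 0 < 1 + ε * ((r - a) / √((r - a) ^ 2 + S)) := fun r =>
      lt_of_lt_of_le (by positivity) (nf_B_aux a S hS ε hε r)
    refine nf_oneD measurableSet_Ioi (fun r _ => hd r)
      (strictMono_of_hasDerivAt_pos hd hpos).injective.injOn w τ m 8 (by simp) ?_
    intro r hr
    by_cases h : 2 * X < √((r - a) ^ 2 + S)
    · simp [hm0 r hr h]
    refine (hm r hr).trans ?_
    have h8 : (8 : ℝ≥0∞) = ENNReal.ofReal 8 := by simp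
    rw [h8, ← ENNReal.ofReal_mul (by norm_num), abs_of_pos (hpos r)]
    apply ENNReal.ofReal_le_ofReal
    have h1 := nf_B_aux a S hS ε hε r
    push Not at h
    have h2 : (r - a) ^ 2 + S ≤ 4 * X ^ 2 := by
      have := Real.sqrt_le_iff.1 h
      nlinarith [this.2]
    have h3 : S / (8 * X ^ 2) ≤ S / (2 * ((r - a) ^ 2 + S)) := by
      apply div_le_div_of_nonneg_left hS.le (by positivity) (by linarith)
    have h4 : S / X ^ 2 = 8 * (S / (8 * X ^ 2)) := by field_simp
    linarith

/-- cross product squared -/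
def nfCross (η ξ : EuclideanSpace ℝ (Fin 3)) : ℝ := ‖η‖ ^ 2 * ‖ξ‖ ^ 2 - inner ℝ η ξ ^ 2

lemma nfCross_nonneg (η ξ : EuclideanSpace ℝ (Fin 3)) : 0 ≤ nfCross η ξ := by
  have := abs_real_inner_le_norm η ξ
  have h2 := sq_le_sq' (by linarith [neg_abs_le (inner ℝ η ξ), abs_nonneg (inner ℝ η ξ)])
    (le_trans (le_abs_self _) this)
  unfold nfCross
  nlinarith

lemma nf_B (w : ℝ → ℝ≥0∞) (hw : Measurable w) (ξ : EuclideanSpace ℝ (Fin 3)) (ε : ℝ)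
    (hε : ε = 1 ∨ ε = -1) (τ : ℝ) :
    ∫⁻ η, (if 2 * ‖η‖ ≤ ‖ξ - η‖ then ENNReal.ofReal (nfCross η ξ / (‖ξ‖ ^ 2 * ‖η‖ ^ 4)) else 0)
      * w (τ - (‖η‖ + ε * ‖ξ - η‖)) ≤
    (8 * ∫⁻ y, w y) * (volume : Measure (EuclideanSpace ℝ (Fin 3))).toSphere Set.univ := by
  apply nf_spherical
  · unfold nfCross
    refine Measurable.mul (Measurable.ite ?_ ?_ ?_) ?_
    · exact measurableSet_le (by fun_prop) (by fun_prop)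
    · fun_prop
    · fun_prop
    · fun_prop
  · intro ω hω
    by_cases hξ : ξ = 0
    · subst hξ; simp
    have hX : 0 < ‖ξ‖ := norm_pos_iff.2 hξ
    have hS := nfCross_nonneg ω ξ
    rw [nfCross, hω] at hS
    refine le_trans (le_of_eq ?_) (nf_B1 (inner ℝ ω ξ) (‖ξ‖ ^ 2 - inner ℝ ω ξ ^ 2) ‖ξ‖ (by linarith)
      hX ε hε w τ (fun r => if 2 * r ≤ ‖ξ - r • ω‖ then
        ENNReal.ofReal ((‖ξ‖ ^ 2 - inner ℝ ω ξ ^ 2) / ‖ξ‖ ^ 2) else 0) ?_ ?_)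
    · refine setLIntegral_congr_fun measurableSet_Ioi fun r hr => ?_
      have hr : 0 < r := hr
      have hn : ‖r • ω‖ = r := by rw [norm_smul, hω, Real.norm_eq_abs, abs_of_pos hr, mul_one]
      simp only [hn, ← nf_rho_eq ξ ω hω r]
      rw [← mul_assoc]
      congr 1
      split_ifs
      · rw [← ENNReal.ofReal_mul (by positivity)]
        congr 1
        rw [nfCross, hn, inner_smul_left]
        simp
        field_simp
      · simp
    · intro r _
      split_ifs <;> simp
    · intro r hr h
      rw [if_neg]
      rw [← nf_rho_eq ξ ω hω r] at h
      have hn : ‖r • ω‖ = r := by rw [norm_smul, hω, Real.norm_eq_abs, abs_of_pos hr, mul_one]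
      have := norm_sub_le ξ (r • ω)
      rw [hn] at this
      linarith

/-- far region -/
lemma nf_A1 (w : ℝ → ℝ≥0∞) (hw : Measurable w) (ξ : EuclideanSpace ℝ (Fin 3)) (τ : ℝ) :
    ∫⁻ η, (if 2 * ‖ξ‖ ≤ ‖η‖ then ENNReal.ofReal (1 / (‖η‖ * ‖ξ - η‖)) else 0)
      * w (τ - (‖η‖ + ‖ξ - η‖)) ≤
    (2 * ∫⁻ y, w y) * (volume : Measure (EuclideanSpace ℝ (Fin 3))).toSphere Set.univ := by
  apply nf_spherical
  · refine Measurable.mul (Measurable.ite ?_ ?_ ?_) ?_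
    · exact measurableSet_le (by fun_prop) (by fun_prop)
    · fun_prop
    · fun_prop
    · fun_prop
  · intro ω hω
    set a := inner ℝ ω ξ with ha
    set S := ‖ξ‖ ^ 2 - a ^ 2 with hS'
    have hS : 0 ≤ S := by
      have := nfCross_nonneg ω ξ
      rw [nfCross, hω] at this
      linarith
    have haX : a ≤ ‖ξ‖ := by
      have := real_inner_le_norm ω ξ
      rw [hω] at this; linarith
    set s : Set ℝ := Set.Ioi 0 ∩ Set.Ici (2 * ‖ξ‖) with hs
    have hsm : MeasurableSet s := measurableSet_Ioi.inter measurableSet_Ici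
    have hlt : ∀ r ∈ s, a < r := by
      rintro r ⟨h1, h2⟩
      simp at h1 h2
      have := norm_nonneg ξ
      linarith
    have hrho : ∀ r : ℝ, ‖ξ - r • ω‖ = √((r - a) ^ 2 + S) := nf_rho_eq ξ ω hω
    have hn : ∀ r : ℝ, 0 < r → ‖r • ω‖ = r := fun r hr => by
      rw [norm_smul, hω, Real.norm_eq_abs, abs_of_pos hr, mul_one]
    have key := nf_oneD hsm (f := fun r => r + √((r - a) ^ 2 + S))
      (f' := fun r => 1 + (r - a) / √((r - a) ^ 2 + S))
      (fun r hr => (hasDerivAt_id r).add (nf_rho_deriv a S r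
        (by have := sub_pos.2 (hlt r hr); positivity)))
      (by
        apply StrictMonoOn.injOn
        intro r hr r' hr' hrr
        have h1 := hlt r hr
        have : √((r - a) ^ 2 + S) ≤ √((r' - a) ^ 2 + S) := by
          apply Real.sqrt_le_sqrt
          nlinarith
        dsimp only
        linarith)
      w τ (fun r => ENNReal.ofReal (r / √((r - a) ^ 2 + S))) 2 (by simp)
      (by
        intro r hr
        have h1 := sub_pos.2 (hlt r hr)
        have h2 : (2 : ℝ≥0∞) = ENNReal.ofReal 2 := by simp
        have h3 : 1 ≤ 1 + (r - a) / √((r - a) ^ 2 + S) := by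
          have : 0 ≤ (r - a) / √((r - a) ^ 2 + S) := by positivity
          linarith
        rw [h2, ← ENNReal.ofReal_mul (by norm_num), abs_of_pos (by linarith)]
        apply ENNReal.ofReal_le_ofReal
        have hr1 : 0 < r := hr.1
        have hr2 : 2 * ‖ξ‖ ≤ r := hr.2
        have h4 : r / 2 ≤ √((r - a) ^ 2 + S) := by
          rw [← hrho r]
          have := norm_sub_norm_le (r • ω) ξ
          rw [hn r hr1, norm_sub_rev] at this
          linarith
        have : r / √((r - a) ^ 2 + S) ≤ 2 := by
          rw [div_le_iff₀ (by linarith)]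
          linarith
        linarith)
    refine le_trans (le_of_eq ?_) key
    rw [hs, Set.inter_comm, ← Measure.restrict_restrict measurableSet_Ici]
    rw [← lintegral_indicator measurableSet_Ici]
    refine setLIntegral_congr_fun measurableSet_Ioi fun r hr => ?_
    have hr : 0 < r := hr
    simp only [Set.indicator, Set.mem_Ici, hn r hr, hrho r]
    split_ifs
    · rw [← mul_assoc, ← ENNReal.ofReal_mul (by positivity)]
      congr 2
      field_simp
    · simp

end

open MeasureTheory
open scoped FourierTransform ENNReal
noncomputable section

lemma nf_fin3 (h : EuclideanSpace ℝ (Fin 3) → ℝ≥0∞) (hh : Measurable h) :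
    ∫⁻ η, h η = ∫⁻ z : ℝ, ∫⁻ p : ℝ × ℝ, h (!₂[z, p.1, p.2]) := by
  have m1 := (PiLp.volume_preserving_toLp (Fin 3))
  have m2 := (volume_preserving_piFinSuccAbove (fun _ : Fin 3 => ℝ) 0).symm
  have m3 := (volume_preserving_finTwoArrow ℝ).symm
  rw [← m1.lintegral_comp hh, ← m2.lintegral_comp (by fun_prop)]
  rw [Measure.volume_eq_prod, lintegral_prod]
  · refine lintegral_congr fun z => ?_
    rw [← m3.lintegral_comp (by fun_prop)]
    refine lintegral_congr fun p => ?_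
    congr 2
    ext i
    fin_cases i <;> rfl
  · fun_prop

lemma nf_polar (K : ℝ → ℝ≥0∞) (hK : Measurable K) :
    ∫⁻ p : ℝ × ℝ, K (p.1 ^ 2 + p.2 ^ 2) =
      ENNReal.ofReal (2 * Real.pi) * ∫⁻ r in Set.Ioi (0 : ℝ), ENNReal.ofReal r * K (r ^ 2) := by
  rw [← lintegral_comp_polarCoord_symm, polarCoord_target, Measure.volume_eq_prod,
    ← Measure.prod_restrict, lintegral_prod]
  · rw [← lintegral_const_mul']
    · refine setLIntegral_congr_fun measurableSet_Ioi fun r hr => ?_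
      have : ∀ y : ℝ, (polarCoord.symm (r, y)).1 ^ 2 + (polarCoord.symm (r, y)).2 ^ 2 = r ^ 2 := by
        intro y
        simp [polarCoord]
        linear_combination (r ^ 2) * Real.sin_sq_add_cos_sq y
      simp only [this]
      rw [lintegral_const]
      simp only [smul_eq_mul, MeasurableSet.univ, Measure.restrict_apply, Set.univ_inter,
        Real.volume_Ioo]
      rw [mul_comm]
      congr 2
      ring
    · exact ENNReal.ofReal_ne_top
  · simp only [polarCoord_symm_apply]
    fun_prop

lemma nf_A2 (w : ℝ → ℝ≥0∞) (hw : Measurable w) (ξ : EuclideanSpace ℝ (Fin 3)) (τ : ℝ) :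
    ∫⁻ η, (if ‖η‖ < 2 * ‖ξ‖ then ENNReal.ofReal (1 / (‖η‖ * ‖ξ - η‖)) else 0)
      * w (τ - (‖η‖ + ‖ξ - η‖)) ≤ ENNReal.ofReal (8 * Real.pi) * ∫⁻ y, w y := by
  by_cases hξ : ξ = 0
  · subst hξ
    have : ∀ η : EuclideanSpace ℝ (Fin 3), ¬ ‖η‖ < 0 := fun η => not_lt.2 (norm_nonneg _)
    simp [this]
  set L := ‖ξ‖ with hL'
  have hL : 0 < L := norm_pos_iff.2 hξ
  set e : EuclideanSpace ℝ (Fin 3) := !₂[L, 0, 0] with he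
  have hne : ‖e‖ = ‖ξ‖ := by
    rw [he, EuclideanSpace.norm_eq]
    simp [Fin.sum_univ_three, Real.sqrt_sq hL.le, ← hL']
  set R := Submodule.reflection (ℝ ∙ (e - ξ))ᗮ with hR
  have hRe : R e = ξ := Submodule.reflection_sub hne
  set h : EuclideanSpace ℝ (Fin 3) → ℝ≥0∞ := fun η =>
    (if ‖η‖ < 2 * L then ENNReal.ofReal (1 / (‖η‖ * ‖e - η‖)) else 0)
      * w (τ - (‖η‖ + ‖e - η‖)) with hh
  have hmeas : Measurable h := by
    refine Measurable.mul (Measurable.ite ?_ ?_ ?_) ?_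
    · exact measurableSet_lt (by fun_prop) (by fun_prop)
    · fun_prop
    · fun_prop
    · fun_prop
  have step : ∫⁻ η, (if ‖η‖ < 2 * L then ENNReal.ofReal (1 / (‖η‖ * ‖ξ - η‖)) else 0)
      * w (τ - (‖η‖ + ‖ξ - η‖)) = ∫⁻ η, h η := by
    rw [← R.measurePreserving.lintegral_comp_emb R.toHomeomorph.measurableEmbedding]
    refine lintegral_congr fun η => ?_
    have : ‖ξ - R η‖ = ‖e - η‖ := by rw [← hRe, ← map_sub, R.norm_map]
    simp only [hh, this, R.norm_map]
  rw [step, nf_fin3 h hmeas]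
  have hnη : ∀ (z : ℝ) (p : ℝ × ℝ), ‖(!₂[z, p.1, p.2] : EuclideanSpace ℝ (Fin 3))‖ =
      √(z ^ 2 + (p.1 ^ 2 + p.2 ^ 2)) := by
    intro z p
    rw [EuclideanSpace.norm_eq]
    simp [Fin.sum_univ_three, add_assoc]
  have hne : ∀ (z : ℝ) (p : ℝ × ℝ), ‖e - (!₂[z, p.1, p.2] : EuclideanSpace ℝ (Fin 3))‖ =
      √((L - z) ^ 2 + (p.1 ^ 2 + p.2 ^ 2)) := by
    intro z p
    rw [EuclideanSpace.norm_eq]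
    simp [Fin.sum_univ_three, add_assoc, he]
  have inner : ∀ z : ℝ, z ≠ 0 → z ≠ L → ∫⁻ p : ℝ × ℝ, h (!₂[z, p.1, p.2]) ≤
      (Set.Icc (-(2 * L)) (2 * L)).indicator
        (fun _ => ENNReal.ofReal (2 * Real.pi) * (ENNReal.ofReal (1 / L) * ∫⁻ y, w y)) z := by
    intro z hz0 hzL
    by_cases hz : z ∈ Set.Icc (-(2 * L)) (2 * L)
    swap
    · rw [Set.indicator_of_notMem hz]
      refine le_of_eq ?_
      rw [lintegral_eq_zero_iff]
      · refine Filter.Eventually.of_forall fun p => ?_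
        simp only [hh, hnη]
        rw [if_neg]
        · simp
        · rw [not_lt]
          apply Real.le_sqrt_of_sq_le
          rw [Set.mem_Icc, ← abs_le, not_le] at hz
          have : (2 * L) ^ 2 ≤ z ^ 2 := by
            rw [← sq_abs z]
            gcongr
          nlinarith [sq_nonneg p.1, sq_nonneg p.2]
      · refine hmeas.comp ?_
        fun_prop
    rw [Set.indicator_of_mem hz]
    set K : ℝ → ℝ≥0∞ := fun q =>
      ENNReal.ofReal (1 / (√(z ^ 2 + q) * √((L - z) ^ 2 + q))) *
        w (τ - (√(z ^ 2 + q) + √((L - z) ^ 2 + q))) with hK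
    have hKm : Measurable K := by fun_prop
    calc ∫⁻ p : ℝ × ℝ, h (!₂[z, p.1, p.2]) ≤ ∫⁻ p : ℝ × ℝ, K (p.1 ^ 2 + p.2 ^ 2) := by
          refine lintegral_mono fun p => ?_
          simp only [hh, hnη, hne, hK]
          gcongr
          split_ifs <;> simp
      _ = _ := nf_polar K hKm
      _ ≤ _ := by
          gcongr
          have hda : ∀ (c x : ℝ), 0 < x → HasDerivAt (fun x : ℝ => √(c ^ 2 + x ^ 2))
              (x / √(c ^ 2 + x ^ 2)) x := by
            intro c x hx
            have h1 : HasDerivAt (fun x : ℝ => c ^ 2 + x ^ 2) (2 * x) x := by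
              simpa using ((hasDerivAt_id x).pow 2).const_add (c ^ 2)
            convert h1.sqrt (by positivity) using 1
            field_simp
          have key := nf_oneD (measurableSet_Ioi (a := (0 : ℝ)))
            (f := fun x => √(z ^ 2 + x ^ 2) + √((L - z) ^ 2 + x ^ 2))
            (fun x hx => (hda z x hx).add (hda (L - z) x hx))
            (by
              apply StrictMonoOn.injOn
              intro x hx y hy hxy
              have hx : 0 < x := hx
              apply add_lt_add <;>
              · apply Real.sqrt_lt_sqrt (by positivity)
                gcongr)
            w τ (fun x => ENNReal.ofReal (x * (1 / (√(z ^ 2 + x ^ 2) * √((L - z) ^ 2 + x ^ 2)))))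
            (ENNReal.ofReal (1 / L)) (by simp)
            (by
              intro x hx
              have hx : 0 < x := hx
              rw [← ENNReal.ofReal_mul (by positivity)]
              apply ENNReal.ofReal_le_ofReal
              have ha : 0 < √(z ^ 2 + x ^ 2) := by positivity
              have hb : 0 < √((L - z) ^ 2 + x ^ 2) := by positivity
              rw [abs_of_pos (by positivity)]
              have h1 : |z| ≤ √(z ^ 2 + x ^ 2) := Real.abs_le_sqrt (by nlinarith)
              have h2 : |L - z| ≤ √((L - z) ^ 2 + x ^ 2) := Real.abs_le_sqrt (by nlinarith)
              have h3 : L ≤ √(z ^ 2 + x ^ 2) + √((L - z) ^ 2 + x ^ 2) := by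
                have := le_abs_self z
                have := le_abs_self (L - z)
                linarith
              generalize √(z ^ 2 + x ^ 2) = A at *
              generalize √((L - z) ^ 2 + x ^ 2) = B at *
              have : 1 / L * (x / A + x / B) = x * (1 / (A * B)) * ((A + B) / L) := by
                field_simp
                ring
              rw [this]
              apply le_mul_of_one_le_right (by positivity)
              rwa [one_le_div hL])
          refine le_trans (le_of_eq ?_) key
          refine setLIntegral_congr_fun measurableSet_Ioi fun x hx => ?_
          have hx : 0 < x := hx
          simp only [hK]
          rw [← mul_assoc, ← ENNReal.ofReal_mul hx.le]
  calc ∫⁻ z : ℝ, ∫⁻ p : ℝ × ℝ, h (!₂[z, p.1, p.2])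
      ≤ ∫⁻ z : ℝ, (Set.Icc (-(2 * L)) (2 * L)).indicator
        (fun _ => ENNReal.ofReal (2 * Real.pi) * (ENNReal.ofReal (1 / L) * ∫⁻ y, w y)) z := by
        apply lintegral_mono_ae
        have h1 : ∀ᵐ z : ℝ, z ≠ 0 := by simp [ae_iff]
        have h2 : ∀ᵐ z : ℝ, z ≠ L := by simp [ae_iff]
        filter_upwards [h1, h2] with z hz1 hz2 using inner z hz1 hz2
    _ = ENNReal.ofReal (8 * Real.pi) * ∫⁻ y, w y := by
        rw [lintegral_indicator measurableSet_Icc, lintegral_const]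
        simp only [MeasurableSet.univ, Measure.restrict_apply, Set.univ_inter, Real.volume_Icc]
        rw [mul_comm, ← mul_assoc, ← mul_assoc, ← ENNReal.ofReal_mul (by linarith),
          ← ENNReal.ofReal_mul (by have := Real.pi_pos; nlinarith)]
        congr 2
        field_simp
        ring

lemma nf_A (w : ℝ → ℝ≥0∞) (hw : Measurable w) (ξ : EuclideanSpace ℝ (Fin 3)) (τ : ℝ) :
    ∫⁻ η, ENNReal.ofReal (1 / (‖η‖ * ‖ξ - η‖)) * w (τ - (‖η‖ + ‖ξ - η‖)) ≤
    (2 * (volume : Measure (EuclideanSpace ℝ (Fin 3))).toSphere Set.univ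
      + ENNReal.ofReal (8 * Real.pi)) * ∫⁻ y, w y := by
  have h1 := nf_A1 w hw ξ τ
  have h2 := nf_A2 w hw ξ τ
  calc _ = ∫⁻ η, ((if 2 * ‖ξ‖ ≤ ‖η‖ then ENNReal.ofReal (1 / (‖η‖ * ‖ξ - η‖)) else 0)
      * w (τ - (‖η‖ + ‖ξ - η‖)) + (if ‖η‖ < 2 * ‖ξ‖ then ENNReal.ofReal (1 / (‖η‖ * ‖ξ - η‖)) else 0)
      * w (τ - (‖η‖ + ‖ξ - η‖))) := by
        refine lintegral_congr fun η => ?_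
        by_cases h : 2 * ‖ξ‖ ≤ ‖η‖
        · simp [h, not_lt.2 h]
        · simp [h, not_le.1 h]
    _ = _ := by
        rw [lintegral_add_left]
        refine Measurable.mul (Measurable.ite ?_ ?_ ?_) ?_
        · exact measurableSet_le (by fun_prop) (by fun_prop)
        · fun_prop
        · fun_prop
        · fun_prop
    _ ≤ _ := by
        refine (add_le_add h1 h2).trans (le_of_eq ?_)
        ring

end

open MeasureTheory
open scoped FourierTransform ENNReal
noncomputable section

lemma nf_add_sq (a b : ℝ≥0∞) : (a + b) ^ 2 ≤ 2 * a ^ 2 + 2 * b ^ 2 := by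
  by_cases ha : a = ⊤
  · simp [ha]
  by_cases hb : b = ⊤
  · simp [hb]
  lift a to NNReal using ha
  lift b to NNReal using hb
  norm_cast
  rw [← NNReal.coe_le_coe]
  push_cast
  nlinarith [sq_nonneg ((a : ℝ) - b)]

lemma nf_cs {α : Type*} [MeasurableSpace α] (μ : Measure α) (k F : α → ℝ≥0∞)
    (hk : AEMeasurable k μ) (hF : AEMeasurable F μ) :
    (∫⁻ x, k x * F x ∂μ) ^ 2 ≤ (∫⁻ x, k x ^ 2 ∂μ) * ∫⁻ x, F x ^ 2 ∂μ := by
  have h := ENNReal.lintegral_mul_le_Lp_mul_Lq μ (p := 2) (q := 2)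
    Real.HolderConjugate.two_two hk hF
  simp only [Pi.mul_apply, ENNReal.rpow_ofNat] at h
  calc _ ≤ _ := pow_le_pow_left' h 2
    _ = _ := by
      rw [mul_pow, ← ENNReal.rpow_mul_natCast, ← ENNReal.rpow_mul_natCast]
      norm_num

lemma nf_spacePart_meas : Measurable spacePart := by
  unfold spacePart
  refine (WithLp.measurable_toLp 2 _).comp ?_
  fun_prop

lemma nf_spacePart_sub (a b : EuclideanSpace ℝ (Fin 4)) :
    spacePart (a - b) = spacePart a - spacePart b := by
  ext i; simp [spacePart]

lemma nf_spacePart_neg (a : EuclideanSpace ℝ (Fin 4)) :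
    spacePart (-a) = - spacePart a := by
  ext i; simp [spacePart]

/-- E4 as product -/
def nfJoin (t : ℝ) (x : EuclideanSpace ℝ (Fin 3)) : EuclideanSpace ℝ (Fin 4) :=
  WithLp.toLp 2 (Fin.cons t (WithLp.ofLp x))

lemma nfJoin_zero (t : ℝ) (x : EuclideanSpace ℝ (Fin 3)) : nfJoin t x 0 = t := rfl

lemma nfJoin_space (t : ℝ) (x : EuclideanSpace ℝ (Fin 3)) : spacePart (nfJoin t x) = x := by
  ext i; simp [spacePart, nfJoin]

lemma nfJoin_mp : MeasurePreserving (fun p : ℝ × EuclideanSpace ℝ (Fin 3) => nfJoin p.1 p.2) := by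
  have m1 := (PiLp.volume_preserving_toLp (Fin 4))
  have m2 := (volume_preserving_piFinSuccAbove (fun _ : Fin 4 => ℝ) 0).symm
  have m3 := (MeasurePreserving.id (volume : Measure ℝ)).prod (PiLp.volume_preserving_ofLp (Fin 3))
  have := (m1.comp m2).comp m3
  convert this using 1
  · ext p i
    refine Fin.cases ?_ (fun i => ?_) i <;> simp [nfJoin, MeasurableEquiv.piFinSuccAbove]
  · rfl

lemma nf_fin4 (h : EuclideanSpace ℝ (Fin 4) → ℝ≥0∞) (hh : Measurable h) :
    ∫⁻ ζ, h ζ = ∫⁻ η : EuclideanSpace ℝ (Fin 3), ∫⁻ t : ℝ, h (nfJoin t η) := by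
  rw [← nfJoin_mp.lintegral_comp hh, Measure.volume_eq_prod, lintegral_prod_symm]
  exact (hh.comp nfJoin_mp.measurable).aemeasurable

/-- general bilinear Cauchy-Schwarz -/
lemma nf_CS (k : EuclideanSpace ℝ (Fin 4) → EuclideanSpace ℝ (Fin 4) → ℝ≥0∞)
    (f g : EuclideanSpace ℝ (Fin 4) → ℝ≥0∞)
    (hk : ∀ ζ, Measurable (k ζ)) (hf : Measurable f) (hg : Measurable g)
    (A : ℝ≥0∞) (hA : ∀ ζ, ∫⁻ ζ₁, k ζ ζ₁ ^ 2 ≤ A) :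
    ∫⁻ ζ, (∫⁻ ζ₁, k ζ ζ₁ * (f ζ₁ * g (ζ - ζ₁))) ^ 2 ≤
      A * ((∫⁻ ζ, f ζ ^ 2) * ∫⁻ ζ, g ζ ^ 2) := by
  calc _ ≤ ∫⁻ ζ, A * ∫⁻ ζ₁, f ζ₁ ^ 2 * g (ζ - ζ₁) ^ 2 := by
        refine lintegral_mono fun ζ => ?_
        refine (nf_cs volume _ _ (hk ζ).aemeasurable (by fun_prop)).trans ?_
        simp only [mul_pow]
        exact mul_le_mul_left (hA ζ) _
    _ = A * ∫⁻ ζ, ∫⁻ ζ₁, f ζ₁ ^ 2 * g (ζ - ζ₁) ^ 2 := by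
        apply lintegral_const_mul
        exact Measurable.lintegral_prod_right (by fun_prop)
    _ = A * ∫⁻ ζ₁, ∫⁻ ζ, f ζ₁ ^ 2 * g (ζ - ζ₁) ^ 2 := by
        rw [lintegral_lintegral_swap]
        exact Measurable.aemeasurable (by fun_prop)
    _ = A * ∫⁻ ζ₁, f ζ₁ ^ 2 * ∫⁻ ζ, g ζ ^ 2 := by
        congr 1
        refine lintegral_congr fun ζ₁ => ?_
        rw [lintegral_const_mul _ (by fun_prop),
          lintegral_sub_right_eq_self (fun ζ => g ζ ^ 2) ζ₁]
    _ = _ := by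
        rw [lintegral_mul_const _ (by fun_prop)]

/-- squared L2 norm of the convolution -/
def nfN (f g : EuclideanSpace ℝ (Fin 4) → ℝ≥0∞) : ℝ≥0∞ :=
  ∫⁻ ζ, (∫⁻ ζ₁, f ζ₁ * g (ζ - ζ₁)) ^ 2

lemma nfN_comm (f g : EuclideanSpace ℝ (Fin 4) → ℝ≥0∞) : nfN f g = nfN g f := by
  unfold nfN
  refine lintegral_congr fun ζ => ?_
  congr 1
  rw [← lintegral_sub_left_eq_self _ ζ]
  refine lintegral_congr fun ζ₁ => ?_
  rw [sub_sub_cancel, mul_comm]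

lemma nfN_expand (f g : EuclideanSpace ℝ (Fin 4) → ℝ≥0∞) (hf : Measurable f) (hg : Measurable g) :
    nfN f g = ∫⁻ a, ∫⁻ b, f a * f b * ∫⁻ ζ, g (ζ - a) * g (ζ - b) := by
  unfold nfN
  calc _ = ∫⁻ ζ, ∫⁻ a, ∫⁻ b, f a * f b * (g (ζ - a) * g (ζ - b)) := by
        refine lintegral_congr fun ζ => ?_
        rw [sq, ← lintegral_mul_const _ (by fun_prop)]
        refine lintegral_congr fun a => ?_
        rw [← lintegral_const_mul _ (by fun_prop)]
        refine lintegral_congr fun b => ?_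
        ring
    _ = ∫⁻ a, ∫⁻ ζ, ∫⁻ b, f a * f b * (g (ζ - a) * g (ζ - b)) := by
        rw [lintegral_lintegral_swap]
        apply Measurable.aemeasurable
        exact Measurable.lintegral_prod_right (by fun_prop)
    _ = ∫⁻ a, ∫⁻ b, ∫⁻ ζ, f a * f b * (g (ζ - a) * g (ζ - b)) := by
        refine lintegral_congr fun a => ?_
        rw [lintegral_lintegral_swap]
        exact Measurable.aemeasurable (by fun_prop)
    _ = _ := by
        refine lintegral_congr fun a => lintegral_congr fun b => ?_
        rw [lintegral_const_mul _ (by fun_prop)]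

lemma nfN_flip (f g : EuclideanSpace ℝ (Fin 4) → ℝ≥0∞) (hf : Measurable f) (hg : Measurable g) :
    nfN f g = nfN f (fun ζ => g (-ζ)) := by
  rw [nfN_expand f g hf hg, nfN_expand f _ hf (by fun_prop)]
  refine lintegral_congr fun a => lintegral_congr fun b => ?_
  congr 1
  rw [← lintegral_sub_left_eq_self _ (a + b)]
  refine lintegral_congr fun ζ => ?_
  rw [mul_comm]
  congr 2 <;> abel

lemma nfN_add_left (f f' g : EuclideanSpace ℝ (Fin 4) → ℝ≥0∞) (hf : Measurable f)
    (hg : Measurable g) :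
    nfN (fun ζ => f ζ + f' ζ) g ≤ 2 * nfN f g + 2 * nfN f' g := by
  unfold nfN
  rw [← lintegral_const_mul' _ _ (by simp), ← lintegral_const_mul' _ _ (by simp),
    ← lintegral_add_left]
  · refine lintegral_mono fun ζ => ?_
    refine le_trans (le_of_eq ?_) (nf_add_sq _ _)
    congr 1
    rw [← lintegral_add_left (by fun_prop)]
    refine lintegral_congr fun ζ₁ => by ring
  · refine Measurable.const_mul (Measurable.pow_const ?_ 2) 2
    exact Measurable.lintegral_prod_right (by fun_prop)

/-- squared modulation weight -/
def nfω (b x : ℝ) : ℝ≥0∞ := ENNReal.ofReal ((1 + x ^ 2) ^ (-b))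

lemma nfω_meas (b : ℝ) : Measurable (nfω b) := by
  unfold nfω; fun_prop

lemma nfω_int (b : ℝ) (hb : 1 / 2 < b) : ∫⁻ x, nfω b x < ⊤ := by
  have h := integrable_rpow_neg_one_add_norm_sq (E := ℝ) (μ := volume) (r := 2 * b)
    (by simp; linarith)
  have h2 := h.lintegral_lt_top
  convert h2 using 3 with x
  unfold nfω
  congr 2
  · simp
  · ring

def nfWW (b x : ℝ) : ℝ≥0∞ := ∫⁻ y, nfω b y * nfω b (x - y)

lemma nfWW_meas (b : ℝ) : Measurable (nfWW b) := by
  have := nfω_meas b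
  unfold nfWW
  exact Measurable.lintegral_prod_right (by fun_prop)

lemma nfWW_int (b : ℝ) (hb : 1 / 2 < b) : ∫⁻ x, nfWW b x < ⊤ := by
  have hm := nfω_meas b
  unfold nfWW
  rw [lintegral_lintegral_swap (Measurable.aemeasurable (by fun_prop))]
  have : ∀ y, ∫⁻ x, nfω b y * nfω b (x - y) = nfω b y * ∫⁻ x, nfω b x := fun y => by
    rw [lintegral_const_mul _ (by fun_prop), lintegral_sub_right_eq_self (nfω b) y]
  simp only [this]
  rw [lintegral_mul_const _ hm]
  exact ENNReal.mul_lt_top (nfω_int b hb) (nfω_int b hb)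

/-- integrating the time variable -/
lemma nf_time (b : ℝ) (κ : EuclideanSpace ℝ (Fin 3) → ℝ≥0∞) (hκ : Measurable κ) (ε₁ ε₂ : ℝ)
    (ζ : EuclideanSpace ℝ (Fin 4)) :
    ∫⁻ ζ₁, κ (spacePart ζ₁) * (nfω b (ζ₁ 0 - ε₁ * ‖spacePart ζ₁‖) *
      nfω b ((ζ - ζ₁) 0 - ε₂ * ‖spacePart (ζ - ζ₁)‖)) =
    ∫⁻ η, κ η * nfWW b (ζ 0 - (ε₁ * ‖η‖ + ε₂ * ‖spacePart ζ - η‖)) := by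
  have hm := nfω_meas b
  have hs := nf_spacePart_meas
  rw [nf_fin4 _ (by fun_prop)]
  refine lintegral_congr fun η => ?_
  simp only [nfJoin_space, nf_spacePart_sub, PiLp.sub_apply, nfJoin_zero]
  rw [lintegral_const_mul _ (by fun_prop)]
  congr 1
  unfold nfWW
  symm
  rw [← lintegral_sub_right_eq_self _ (ε₁ * ‖η‖)]
  refine lintegral_congr fun t => ?_
  congr 2
  ring

end

open MeasureTheory
open scoped FourierTransform ENNReal
noncomputable section

def nfM (b : ℝ) (ζ : EuclideanSpace ℝ (Fin 4)) : ℝ≥0∞ :=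
  ENNReal.ofReal ((1 + (|ζ 0| - ‖spacePart ζ‖) ^ 2) ^ (-(b / 2)))

def nfMs (b ε : ℝ) (ζ : EuclideanSpace ℝ (Fin 4)) : ℝ≥0∞ :=
  ENNReal.ofReal ((1 + (ζ 0 - ε * ‖spacePart ζ‖) ^ 2) ^ (-(b / 2)))

lemma nfM_meas (b : ℝ) : Measurable (nfM b) := by
  have hs := nf_spacePart_meas
  unfold nfM; fun_prop

lemma nfMs_meas (b ε : ℝ) : Measurable (nfMs b ε) := by
  have hs := nf_spacePart_meas
  unfold nfMs; fun_prop

lemma nfMs_sq (b ε : ℝ) (ζ : EuclideanSpace ℝ (Fin 4)) :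
    nfMs b ε ζ ^ 2 = nfω b (ζ 0 - ε * ‖spacePart ζ‖) := by
  unfold nfMs nfω
  rw [← ENNReal.ofReal_pow (by positivity), ← Real.rpow_mul_natCast (by positivity)]
  congr 2
  push_cast
  ring

lemma nfM_cases (b : ℝ) (ζ : EuclideanSpace ℝ (Fin 4)) :
    nfM b ζ = nfMs b 1 ζ ∨ nfM b ζ = nfMs b (-1) ζ := by
  unfold nfM nfMs
  rcases abs_cases (ζ 0) with ⟨h, _⟩ | ⟨h, _⟩
  · left; rw [h, one_mul]
  · right
    congr 3
    rw [h]; ring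

lemma nfM_le (b : ℝ) (ζ : EuclideanSpace ℝ (Fin 4)) :
    nfM b ζ ≤ nfMs b 1 ζ + nfMs b (-1) ζ := by
  rcases nfM_cases b ζ with h | h <;> rw [h] <;> simp

lemma nfM_sq_le (b : ℝ) (ζ : EuclideanSpace ℝ (Fin 4)) :
    nfM b ζ ^ 2 ≤ nfω b (ζ 0 - 1 * ‖spacePart ζ‖) + nfω b (ζ 0 - (-1) * ‖spacePart ζ‖) := by
  rcases nfM_cases b ζ with h | h <;> rw [h, nfMs_sq] <;> simp

lemma nfMs_neg (b ε : ℝ) (ζ : EuclideanSpace ℝ (Fin 4)) : nfMs b ε (-ζ) = nfMs b (-ε) ζ := by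
  unfold nfMs
  rw [nf_spacePart_neg, norm_neg]
  congr 3
  simp
  ring

def nfκ (ζ : EuclideanSpace ℝ (Fin 4)) : ℝ≥0∞ := ENNReal.ofReal (1 / √‖spacePart ζ‖)

lemma nfκ_meas : Measurable nfκ := by
  have hs := nf_spacePart_meas
  unfold nfκ; fun_prop

lemma nfκ_neg (ζ : EuclideanSpace ℝ (Fin 4)) : nfκ (-ζ) = nfκ ζ := by
  unfold nfκ; rw [nf_spacePart_neg, norm_neg]

/-- constant for A -/
def nfCA (b : ℝ) : ℝ≥0∞ := (2 * (volume : Measure (EuclideanSpace ℝ (Fin 3))).toSphere Set.univ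
      + ENNReal.ofReal (8 * Real.pi)) * ∫⁻ y, nfWW b y

lemma nfCA_lt (b : ℝ) (hb : 1 / 2 < b) : nfCA b < ⊤ := by
  unfold nfCA
  refine ENNReal.mul_lt_top ?_ (nfWW_int b hb)
  refine ENNReal.add_lt_top.2 ⟨ENNReal.mul_lt_top (by simp) (measure_lt_top _ _), ENNReal.ofReal_lt_top⟩

lemma nf_TApp (b : ℝ) (f g : EuclideanSpace ℝ (Fin 4) → ℝ≥0∞)
    (hf : Measurable f) (hg : Measurable g) :
    nfN (fun ζ => nfκ ζ * nfMs b 1 ζ * f ζ) (fun ζ => nfκ ζ * nfMs b 1 ζ * g ζ) ≤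
      nfCA b * ((∫⁻ ζ, f ζ ^ 2) * ∫⁻ ζ, g ζ ^ 2) := by
  have h1 := nfκ_meas
  have h2 := nfMs_meas b 1
  have h3 := nf_spacePart_meas
  have := nf_CS (fun ζ ζ₁ => nfκ ζ₁ * nfMs b 1 ζ₁ * (nfκ (ζ - ζ₁) * nfMs b 1 (ζ - ζ₁))) f g
    (fun ζ => by fun_prop) hf hg (nfCA b) ?_
  · refine le_trans (le_of_eq ?_) this
    unfold nfN
    refine lintegral_congr fun ζ => ?_
    congr 1
    refine lintegral_congr fun ζ₁ => ?_
    ring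
  · intro ζ
    have key := nf_A (nfWW b) (nfWW_meas b) (spacePart ζ) (ζ 0)
    have ht := nf_time b (fun η => ENNReal.ofReal (1 / (‖η‖ * ‖spacePart ζ - η‖)))
      (by fun_prop) 1 1 ζ
    simp only [one_mul] at ht
    rw [← ht] at key
    refine le_trans (le_of_eq ?_) key
    refine lintegral_congr fun ζ₁ => ?_
    simp only [mul_pow, nfMs_sq, one_mul]
    rw [mul_mul_mul_comm]
    congr 1
    unfold nfκ
    rw [← mul_pow, ← ENNReal.ofReal_mul (by positivity), ← ENNReal.ofReal_pow (by positivity)]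
    congr 1
    rw [nf_spacePart_sub, mul_pow, div_pow, div_pow, Real.sq_sqrt (norm_nonneg _),
      Real.sq_sqrt (norm_nonneg _)]
    simp [mul_comm]

lemma nf_TAs (b ε₁ ε₂ : ℝ) (hε₁ : ε₁ = 1 ∨ ε₁ = -1) (hε₂ : ε₂ = 1 ∨ ε₂ = -1)
    (f g : EuclideanSpace ℝ (Fin 4) → ℝ≥0∞)
    (hf : Measurable f) (hg : Measurable g) :
    nfN (fun ζ => nfκ ζ * nfMs b ε₁ ζ * f ζ) (fun ζ => nfκ ζ * nfMs b ε₂ ζ * g ζ) ≤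
      nfCA b * ((∫⁻ ζ, f ζ ^ 2) * ∫⁻ ζ, g ζ ^ 2) := by
  have h1 := nfκ_meas
  have h2 := nfMs_meas b
  have flip1 : ∀ (f g : EuclideanSpace ℝ (Fin 4) → ℝ≥0∞) (_ : Measurable f) (_ : Measurable g),
      nfN (fun ζ => nfκ ζ * nfMs b 1 ζ * f ζ) (fun ζ => nfκ ζ * nfMs b ε₂ ζ * g ζ) ≤
      nfCA b * ((∫⁻ ζ, f ζ ^ 2) * ∫⁻ ζ, g ζ ^ 2) := by
    intro f g hf hg
    rcases hε₂ with rfl | rfl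
    · exact nf_TApp b f g hf hg
    · rw [nfN_flip _ _ (by fun_prop) (by fun_prop)]
      simp only [nfκ_neg, nfMs_neg, neg_neg]
      refine (nf_TApp b f (fun ζ => g (-ζ)) hf (by fun_prop)).trans (le_of_eq ?_)
      rw [lintegral_neg_eq_self (fun ζ => g ζ ^ 2)]
  rcases hε₁ with rfl | rfl
  · exact flip1 f g hf hg
  · rw [nfN_comm, nfN_flip _ _ (by fun_prop) (by fun_prop), nfN_comm]
    simp only [nfκ_neg, nfMs_neg, neg_neg]
    refine (flip1 (fun ζ => f (-ζ)) g (by fun_prop) hg).trans (le_of_eq ?_)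
    rw [lintegral_neg_eq_self (fun ζ => f ζ ^ 2)]

lemma nfN_mono {f f' g g' : EuclideanSpace ℝ (Fin 4) → ℝ≥0∞} (hf : ∀ ζ, f ζ ≤ f' ζ)
    (hg : ∀ ζ, g ζ ≤ g' ζ) : nfN f g ≤ nfN f' g' := by
  unfold nfN
  gcongr with ζ ζ₁
  · exact hf _
  · exact hg _

lemma nf_TA (b : ℝ) (f g : EuclideanSpace ℝ (Fin 4) → ℝ≥0∞)
    (hf : Measurable f) (hg : Measurable g) :
    nfN (fun ζ => nfκ ζ * nfM b ζ * f ζ) (fun ζ => nfκ ζ * nfM b ζ * g ζ) ≤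
      16 * nfCA b * ((∫⁻ ζ, f ζ ^ 2) * ∫⁻ ζ, g ζ ^ 2) := by
  have h1 := nfκ_meas
  have h2 := nfMs_meas b
  set X := nfCA b * ((∫⁻ ζ, f ζ ^ 2) * ∫⁻ ζ, g ζ ^ 2) with hX
  have hle : ∀ (f : EuclideanSpace ℝ (Fin 4) → ℝ≥0∞) ζ, nfκ ζ * nfM b ζ * f ζ ≤
      nfκ ζ * nfMs b 1 ζ * f ζ + nfκ ζ * nfMs b (-1) ζ * f ζ := by
    intro f ζ
    rw [← add_mul, ← mul_add]
    gcongr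
    exact nfM_le b ζ
  refine (nfN_mono (hle f) (hle g)).trans ?_
  refine (nfN_add_left _ _ _ (by fun_prop) (by fun_prop)).trans ?_
  have hG : ∀ ε : ℝ, ε = 1 ∨ ε = -1 → nfN (fun ζ => nfκ ζ * nfMs b ε ζ * f ζ)
      (fun ζ => nfκ ζ * nfMs b 1 ζ * g ζ + nfκ ζ * nfMs b (-1) ζ * g ζ) ≤ 2 * X + 2 * X := by
    intro ε hε
    rw [nfN_comm]
    refine (nfN_add_left _ _ _ (by fun_prop) (by fun_prop)).trans ?_
    rw [nfN_comm _ (fun ζ => nfκ ζ * nfMs b ε ζ * f ζ), nfN_comm _ (fun ζ => nfκ ζ * nfMs b ε ζ * f ζ)]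
    gcongr
    · exact nf_TAs b ε 1 hε (Or.inl rfl) f g hf hg
    · exact nf_TAs b ε (-1) hε (Or.inr rfl) f g hf hg
  calc _ ≤ 2 * (2 * X + 2 * X) + 2 * (2 * X + 2 * X) := by
        gcongr
        · exact hG 1 (Or.inl rfl)
        · exact hG (-1) (Or.inr rfl)
    _ ≤ _ := by
        rw [mul_assoc, ← hX]
        have : 2 * (2 * X + 2 * X) + 2 * (2 * X + 2 * X) = 16 * X := by ring
        exact this.le

def nfkB (ξ η : EuclideanSpace ℝ (Fin 3)) : ℝ≥0∞ :=
  if 2 * ‖η‖ ≤ ‖ξ - η‖ then ENNReal.ofReal (√(nfCross η ξ) / (‖ξ‖ * ‖η‖ ^ 2)) else 0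

lemma nfkB_meas : Measurable (fun p : EuclideanSpace ℝ (Fin 3) × EuclideanSpace ℝ (Fin 3) =>
    nfkB p.1 p.2) := by
  unfold nfkB nfCross
  refine Measurable.ite ?_ ?_ ?_
  · exact measurableSet_le (by fun_prop) (by fun_prop)
  · fun_prop
  · fun_prop

def nfCB (b : ℝ) : ℝ≥0∞ :=
  (8 * ∫⁻ y, nfWW b y) * (volume : Measure (EuclideanSpace ℝ (Fin 3))).toSphere Set.univ

lemma nfCB_lt (b : ℝ) (hb : 1 / 2 < b) : nfCB b < ⊤ := by
  unfold nfCB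
  exact ENNReal.mul_lt_top (ENNReal.mul_lt_top (by simp) (nfWW_int b hb)) (measure_lt_top _ _)

lemma nf_Bs (b ε₁ ε₂ : ℝ) (hε₁ : ε₁ = 1 ∨ ε₁ = -1) (hε₂ : ε₂ = 1 ∨ ε₂ = -1)
    (ζ : EuclideanSpace ℝ (Fin 4)) :
    ∫⁻ ζ₁, nfkB (spacePart ζ) (spacePart ζ₁) ^ 2 * (nfω b (ζ₁ 0 - ε₁ * ‖spacePart ζ₁‖) *
      nfω b ((ζ - ζ₁) 0 - ε₂ * ‖spacePart (ζ - ζ₁)‖)) ≤ nfCB b := by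
  have hkm : Measurable fun η => nfkB (spacePart ζ) η ^ 2 :=
    (nfkB_meas.comp (measurable_const.prodMk measurable_id)).pow_const 2
  rw [nf_time b (fun η => nfkB (spacePart ζ) η ^ 2) hkm ε₁ ε₂ ζ]
  have hk : ∀ η, nfkB (spacePart ζ) η ^ 2 = if 2 * ‖η‖ ≤ ‖spacePart ζ - η‖ then
      ENNReal.ofReal (nfCross η (spacePart ζ) / (‖spacePart ζ‖ ^ 2 * ‖η‖ ^ 4)) else 0 := by
    intro η
    unfold nfkB
    split_ifs
    · rw [← ENNReal.ofReal_pow (by positivity), div_pow, Real.sq_sqrt (nfCross_nonneg _ _)]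
      congr 2
      ring
    · simp
  simp only [hk]
  rcases hε₁ with rfl | rfl
  · simp only [one_mul]
    exact nf_B (nfWW b) (nfWW_meas b) (spacePart ζ) ε₂ hε₂ (ζ 0)
  · have := nf_B (fun x => nfWW b (-x)) ((nfWW_meas b).comp measurable_neg) (spacePart ζ) (-ε₂)
      (by rcases hε₂ with rfl | rfl <;> simp) (-(ζ 0))
    rw [lintegral_neg_eq_self (nfWW b)] at this
    refine le_trans (le_of_eq ?_) this
    refine lintegral_congr fun η => ?_
    congr 2
    ring

lemma nf_kBm (ζ : EuclideanSpace ℝ (Fin 4)) : Measurable fun ζ₁ : EuclideanSpace ℝ (Fin 4) =>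
    nfkB (spacePart ζ) (spacePart ζ₁) := by
  have h3 := nf_spacePart_meas
  generalize spacePart ζ = ξ
  have h : Measurable fun η => nfkB ξ η := by
    unfold nfkB nfCross
    refine Measurable.ite ?_ ?_ ?_
    · exact measurableSet_le (by fun_prop) (by fun_prop)
    · fun_prop
    · fun_prop
  generalize nfkB ξ = F at h ⊢
  exact h.comp h3

lemma nf_Bker (b : ℝ) (ζ : EuclideanSpace ℝ (Fin 4)) :
    ∫⁻ ζ₁, (nfkB (spacePart ζ) (spacePart ζ₁) * nfM b ζ₁ * nfM b (ζ - ζ₁)) ^ 2 ≤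
      4 * nfCB b := by
  have hp : (1 : ℝ) = 1 ∨ (1 : ℝ) = -1 := Or.inl rfl
  have hn : (-1 : ℝ) = 1 ∨ (-1 : ℝ) = -1 := Or.inr rfl
  have h2 := nfω_meas b
  have h3 := nf_spacePart_meas
  have h4 := nf_kBm ζ
  let F : ℝ → ℝ → EuclideanSpace ℝ (Fin 4) → ℝ≥0∞ := fun ε₁ ε₂ ζ₁ =>
    nfkB (spacePart ζ) (spacePart ζ₁) ^ 2 * (nfω b (ζ₁ 0 - ε₁ * ‖spacePart ζ₁‖) *
      nfω b ((ζ - ζ₁) 0 - ε₂ * ‖spacePart (ζ - ζ₁)‖))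
  have hF : ∀ ε₁ ε₂, Measurable (F ε₁ ε₂) := by
    intro ε₁ ε₂
    simp only [F]
    fun_prop
  have e1 : ∫⁻ ζ₁, F 1 1 ζ₁ ≤ nfCB b := nf_Bs b 1 1 hp hp ζ
  have e2 : ∫⁻ ζ₁, F 1 (-1) ζ₁ ≤ nfCB b := nf_Bs b 1 (-1) hp hn ζ
  have e3 : ∫⁻ ζ₁, F (-1) 1 ζ₁ ≤ nfCB b := nf_Bs b (-1) 1 hn hp ζ
  have e4 : ∫⁻ ζ₁, F (-1) (-1) ζ₁ ≤ nfCB b := nf_Bs b (-1) (-1) hn hn ζ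
  have hpt : ∀ ζ₁, (nfkB (spacePart ζ) (spacePart ζ₁) * nfM b ζ₁ * nfM b (ζ - ζ₁)) ^ 2 ≤
      (F 1 1 ζ₁ + F 1 (-1) ζ₁) + (F (-1) 1 ζ₁ + F (-1) (-1) ζ₁) := by
    intro ζ₁
    rw [mul_pow, mul_pow, mul_assoc]
    refine (mul_le_mul_right (mul_le_mul' (nfM_sq_le b ζ₁) (nfM_sq_le b (ζ - ζ₁))) _).trans
      (le_of_eq ?_)
    simp only [F]
    rw [add_mul, mul_add, mul_add, mul_add, mul_add, mul_add]
  clear_value F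
  refine (lintegral_mono hpt).trans ?_
  rw [lintegral_add_left (by fun_prop), lintegral_add_left (hF _ _),
    lintegral_add_left (hF _ _)]
  calc _ ≤ (nfCB b + nfCB b) + (nfCB b + nfCB b) := by gcongr
    _ = 4 * nfCB b := by ring

lemma nf_TB (b : ℝ) (f g : EuclideanSpace ℝ (Fin 4) → ℝ≥0∞)
    (hf : Measurable f) (hg : Measurable g) :
    ∫⁻ ζ, (∫⁻ ζ₁, nfkB (spacePart ζ) (spacePart ζ₁) * nfM b ζ₁ * nfM b (ζ - ζ₁) *
      (f ζ₁ * g (ζ - ζ₁))) ^ 2 ≤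
      4 * nfCB b * ((∫⁻ ζ, f ζ ^ 2) * ∫⁻ ζ, g ζ ^ 2) := by
  have h1 := nfM_meas b
  have h4 := nf_kBm
  exact nf_CS (fun ζ ζ₁ => nfkB (spacePart ζ) (spacePart ζ₁) * nfM b ζ₁ * nfM b (ζ - ζ₁)) f g
    (fun ζ => ((h4 ζ).mul h1).mul (h1.comp (measurable_const.sub measurable_id))) hf hg
    (4 * nfCB b) (nf_Bker b)

lemma nfCross_sub (η ξ : EuclideanSpace ℝ (Fin 3)) : nfCross (ξ - η) ξ = nfCross η ξ := by
  unfold nfCross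
  rw [@norm_sub_sq_real, inner_sub_left, real_inner_self_eq_norm_sq, real_inner_comm]
  ring

lemma nf_TB' (b : ℝ) (f g : EuclideanSpace ℝ (Fin 4) → ℝ≥0∞)
    (hf : Measurable f) (hg : Measurable g) :
    ∫⁻ ζ, (∫⁻ ζ₁, nfkB (spacePart ζ) (spacePart (ζ - ζ₁)) * nfM b ζ₁ * nfM b (ζ - ζ₁) *
      (f ζ₁ * g (ζ - ζ₁))) ^ 2 ≤
      4 * nfCB b * ((∫⁻ ζ, f ζ ^ 2) * ∫⁻ ζ, g ζ ^ 2) := by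
  rw [mul_comm (∫⁻ ζ, f ζ ^ 2)]
  refine le_trans (le_of_eq ?_) (nf_TB b g f hg hf)
  refine lintegral_congr fun ζ => ?_
  congr 1
  rw [← lintegral_sub_left_eq_self _ ζ]
  refine lintegral_congr fun ζ₁ => ?_
  rw [sub_sub_cancel]
  ring

end

open MeasureTheory
open scoped FourierTransform ENNReal
noncomputable section

lemma nf_q_le (i j : Fin 3) (ξ η : EuclideanSpace ℝ (Fin 3)) :
    |η i * (ξ - η) j - η j * (ξ - η) i| ≤ √(nfCross η ξ) := by
  apply Real.abs_le_sqrt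
  unfold nfCross
  rw [EuclideanSpace.norm_sq_eq, EuclideanSpace.norm_sq_eq, PiLp.inner_apply]
  simp only [Fin.sum_univ_three, Real.norm_eq_abs, sq_abs, PiLp.sub_apply]
  simp only [RCLike.inner_apply, conj_trivial]
  have h1 := sq_nonneg (η 0 * ξ 1 - η 1 * ξ 0)
  have h2 := sq_nonneg (η 0 * ξ 2 - η 2 * ξ 0)
  have h3 := sq_nonneg (η 1 * ξ 2 - η 2 * ξ 1)
  fin_cases i <;> fin_cases j <;> simp <;> nlinarith

lemma nfCross_le (η ξ : EuclideanSpace ℝ (Fin 3)) : √(nfCross η ξ) ≤ ‖η‖ * ‖ξ‖ := by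
  apply Real.sqrt_le_iff.2 ⟨by positivity, ?_⟩
  unfold nfCross
  nlinarith [sq_nonneg (inner ℝ η ξ)]

lemma nf_sc_a (s₁ s₂ r ρ R : ℝ) (hs₁ : s₁ ≤ 2) (hs₂ : s₂ ≤ 2) (hsum : 2 ≤ s₁ + s₂)
    (hr : 0 < r) (hR : 0 < R) (h1 : r ≤ ρ) (h2 : R ≤ 2 * ρ) :
    R ^ (s₁ + s₂ - 3) * r ^ (-s₁) * ρ ^ (-s₂) ≤ 4 / (R * r ^ 2) := by
  have hρ : 0 < ρ := lt_of_lt_of_le hr h1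
  rw [le_div_iff₀ (by positivity)]
  have e1 : R ^ (s₁ + s₂ - 3) * R = R ^ (s₁ + s₂ - 2) := by
    rw [← Real.rpow_add_one hR.ne']; congr 1; ring
  have e2 : r ^ (-s₁) * r ^ 2 = r ^ (2 - s₁) := by
    rw [← Real.rpow_natCast, ← Real.rpow_add hr]; congr 1; push_cast; ring
  have e3 : R ^ (s₁ + s₂ - 2) ≤ 4 * ρ ^ (s₁ + s₂ - 2) := by
    calc R ^ (s₁ + s₂ - 2) ≤ (2 * ρ) ^ (s₁ + s₂ - 2) :=
          Real.rpow_le_rpow hR.le h2 (by linarith)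
      _ = 2 ^ (s₁ + s₂ - 2) * ρ ^ (s₁ + s₂ - 2) := Real.mul_rpow (by norm_num) hρ.le
      _ ≤ 4 * ρ ^ (s₁ + s₂ - 2) := by
          gcongr
          calc (2 : ℝ) ^ (s₁ + s₂ - 2) ≤ 2 ^ (2 : ℝ) :=
                Real.rpow_le_rpow_of_exponent_le (by norm_num) (by linarith)
            _ = 4 := by norm_num
  have e4 : r ^ (2 - s₁) ≤ ρ ^ (2 - s₁) := Real.rpow_le_rpow hr.le h1 (by linarith)
  have e5 : ρ ^ (s₁ + s₂ - 2) * ρ ^ (2 - s₁) * ρ ^ (-s₂) = 1 := by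
    rw [← Real.rpow_add hρ, ← Real.rpow_add hρ]
    convert Real.rpow_zero ρ using 2; ring
  calc _ = (R ^ (s₁ + s₂ - 3) * R) * (r ^ (-s₁) * r ^ 2) * ρ ^ (-s₂) := by ring
    _ ≤ (4 * ρ ^ (s₁ + s₂ - 2)) * ρ ^ (2 - s₁) * ρ ^ (-s₂) := by
        rw [e1, e2]; gcongr
    _ = 4 := by rw [mul_assoc, mul_assoc, ← mul_assoc (ρ ^ (s₁ + s₂ - 2)), e5, mul_one]

lemma nf_sc_c (s₁ s₂ r ρ R : ℝ) (hs₁ : s₁ ≤ 2) (hs₂ : s₂ ≤ 2) (hsum : 2 ≤ s₁ + s₂)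
    (hr : 0 < r) (hρ : 0 < ρ) (hR : 0 < R) (h1 : r ≤ 2 * ρ) (h1' : ρ ≤ 2 * r) (h2 : R ≤ 3 * ρ) :
    R ^ (s₁ + s₂ - 3) * (r * R) * r ^ (-s₁) * ρ ^ (-s₂) ≤ 36 * (1 / √r * (1 / √ρ)) := by
  have hrs : √r = r ^ (1 / 2 : ℝ) := Real.sqrt_eq_rpow r
  have hρs : √ρ = ρ ^ (1 / 2 : ℝ) := Real.sqrt_eq_rpow ρ
  have a1 : r * r ^ (-s₁) = r ^ (3 / 2 - s₁) * (1 / √r) := by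
    rw [hrs, one_div, ← Real.rpow_neg hr.le, ← Real.rpow_add hr, mul_comm,
      ← Real.rpow_add_one hr.ne']
    congr 1; ring
  have a2 : ρ ^ (-s₂) = ρ ^ (1 / 2 - s₂) * (1 / √ρ) := by
    rw [hρs, one_div (ρ ^ (1 / 2 : ℝ)), ← Real.rpow_neg hρ.le, ← Real.rpow_add hρ]
    congr 1; ring
  have e1 : R ^ (s₁ + s₂ - 3) * R = R ^ (s₁ + s₂ - 2) := by
    rw [← Real.rpow_add_one hR.ne']; congr 1; ring
  have e3 : R ^ (s₁ + s₂ - 2) ≤ 9 * ρ ^ (s₁ + s₂ - 2) := by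
    calc R ^ (s₁ + s₂ - 2) ≤ (3 * ρ) ^ (s₁ + s₂ - 2) :=
          Real.rpow_le_rpow hR.le h2 (by linarith)
      _ = 3 ^ (s₁ + s₂ - 2) * ρ ^ (s₁ + s₂ - 2) := Real.mul_rpow (by norm_num) hρ.le
      _ ≤ 9 * ρ ^ (s₁ + s₂ - 2) := by
          gcongr
          calc (3 : ℝ) ^ (s₁ + s₂ - 2) ≤ 3 ^ (2 : ℝ) :=
                Real.rpow_le_rpow_of_exponent_le (by norm_num) (by linarith)
            _ = 9 := by norm_num
  have e4 : r ^ (3 / 2 - s₁) ≤ 4 * ρ ^ (3 / 2 - s₁) := by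
    have h22 : ∀ e : ℝ, e ≤ 2 → (2 : ℝ) ^ e ≤ 4 := by
      intro e he
      calc (2 : ℝ) ^ e ≤ 2 ^ (2 : ℝ) :=
            Real.rpow_le_rpow_of_exponent_le (by norm_num) he
        _ = 4 := by norm_num
    rcases le_total 0 (3 / 2 - s₁) with he | he
    · calc r ^ (3 / 2 - s₁) ≤ (2 * ρ) ^ (3 / 2 - s₁) := Real.rpow_le_rpow hr.le h1 he
        _ = 2 ^ (3 / 2 - s₁) * ρ ^ (3 / 2 - s₁) := Real.mul_rpow (by norm_num) hρ.le
        _ ≤ _ := by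
          gcongr
          exact h22 _ (by linarith)
    · calc r ^ (3 / 2 - s₁) ≤ (ρ / 2) ^ (3 / 2 - s₁) :=
            Real.rpow_le_rpow_of_nonpos (by positivity) (by linarith) he
        _ = 2 ^ (-(3 / 2 - s₁)) * ρ ^ (3 / 2 - s₁) := by
          rw [Real.div_rpow hρ.le (by norm_num), Real.rpow_neg (by norm_num)]
          field_simp
        _ ≤ _ := by
          gcongr
          exact h22 _ (by linarith)
  have e5 : ρ ^ (s₁ + s₂ - 2) * ρ ^ (3 / 2 - s₁) * ρ ^ (1 / 2 - s₂) = 1 := by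
    rw [← Real.rpow_add hρ, ← Real.rpow_add hρ]
    convert Real.rpow_zero ρ using 2; ring
  calc _ = (R ^ (s₁ + s₂ - 3) * R) * (r * r ^ (-s₁)) * ρ ^ (-s₂) := by ring
    _ = R ^ (s₁ + s₂ - 2) * r ^ (3 / 2 - s₁) * ρ ^ (1 / 2 - s₂) * (1 / √r * (1 / √ρ)) := by
        rw [e1, a1, a2]; ring
    _ ≤ (9 * ρ ^ (s₁ + s₂ - 2)) * (4 * ρ ^ (3 / 2 - s₁)) * ρ ^ (1 / 2 - s₂)
          * (1 / √r * (1 / √ρ)) := by gcongr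
    _ = 36 * (ρ ^ (s₁ + s₂ - 2) * ρ ^ (3 / 2 - s₁) * ρ ^ (1 / 2 - s₂))
          * (1 / √r * (1 / √ρ)) := by ring
    _ = _ := by rw [e5, mul_one]

lemma nf_japanese (s r : ℝ) (hs : 0 ≤ s) (hr : 0 < r) : (1 + r ^ 2) ^ (-(s / 2)) ≤ r ^ (-s) := by
  have : r ^ (-s) = (r ^ 2) ^ (-(s / 2)) := by
    rw [← Real.rpow_natCast, ← Real.rpow_mul hr.le]; congr 1; push_cast; ring
  rw [this]
  exact Real.rpow_le_rpow_of_nonpos (by positivity) (by linarith) (by linarith)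

lemma nf_pointwise (s₁ s₂ : ℝ) (hs₁ : s₁ ≤ 2) (hs₂ : s₂ ≤ 2) (hsum : 2 ≤ s₁ + s₂)
    (i j : Fin 3) (ξ η : EuclideanSpace ℝ (Fin 3)) :
    ENNReal.ofReal (‖ξ‖ ^ (s₁ + s₂ - 3) * |η i * (ξ - η) j - η j * (ξ - η) i| *
      (1 + ‖η‖ ^ 2) ^ (-(s₁ / 2)) * (1 + ‖ξ - η‖ ^ 2) ^ (-(s₂ / 2))) ≤
    36 * (ENNReal.ofReal (1 / √‖η‖) * ENNReal.ofReal (1 / √‖ξ - η‖) + nfkB ξ η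
      + nfkB ξ (ξ - η)) := by
  have hq := nf_q_le i j ξ η
  by_cases hz : ‖η‖ = 0 ∨ ‖ξ - η‖ = 0 ∨ ‖ξ‖ = 0
  · have hX : √(nfCross η ξ) = 0 := by
      rcases hz with h | h | h
      · have := nfCross_le η ξ
        rw [h, zero_mul] at this
        exact le_antisymm this (Real.sqrt_nonneg _)
      · have := nfCross_le (ξ - η) ξ
        rw [h, zero_mul, nfCross_sub] at this
        exact le_antisymm this (Real.sqrt_nonneg _)
      · have := nfCross_le η ξ
        rw [h, mul_zero] at this
        exact le_antisymm this (Real.sqrt_nonneg _)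
    have : |η i * (ξ - η) j - η j * (ξ - η) i| = 0 :=
      le_antisymm (hq.trans hX.le) (abs_nonneg _)
    rw [this]
    simp
  · push Not at hz
    obtain ⟨hr, hρ, hR⟩ := hz
    have hr : 0 < ‖η‖ := lt_of_le_of_ne (norm_nonneg _) hr.symm
    have hρ : 0 < ‖ξ - η‖ := lt_of_le_of_ne (norm_nonneg _) hρ.symm
    have hR : 0 < ‖ξ‖ := lt_of_le_of_ne (norm_nonneg _) hR.symm
    have t1 : ‖ξ‖ ≤ ‖η‖ + ‖ξ - η‖ := by
      simpa using norm_add_le η (ξ - η)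
    have j1 := nf_japanese s₁ ‖η‖ (by linarith) hr
    have j2 := nf_japanese s₂ ‖ξ - η‖ (by linarith) hρ
    have hX0 := Real.sqrt_nonneg (nfCross η ξ)
    have base : ‖ξ‖ ^ (s₁ + s₂ - 3) * |η i * (ξ - η) j - η j * (ξ - η) i| *
      (1 + ‖η‖ ^ 2) ^ (-(s₁ / 2)) * (1 + ‖ξ - η‖ ^ 2) ^ (-(s₂ / 2)) ≤
      ‖ξ‖ ^ (s₁ + s₂ - 3) * √(nfCross η ξ) * ‖η‖ ^ (-s₁) * ‖ξ - η‖ ^ (-s₂) := by gcongr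
    refine (ENNReal.ofReal_le_ofReal base).trans ?_
    rw [← ENNReal.ofReal_mul (by positivity)]
    have h36 : (36 : ℝ≥0∞) = ENNReal.ofReal 36 := by norm_num
    by_cases ha : 2 * ‖η‖ ≤ ‖ξ - η‖
    · have key := nf_sc_a s₁ s₂ ‖η‖ ‖ξ - η‖ ‖ξ‖ hs₁ hs₂ hsum hr hR (by linarith) (by linarith)
      have : 36 * nfkB ξ η ≤ 36 * (ENNReal.ofReal (1 / √‖η‖ * (1 / √‖ξ - η‖)) + nfkB ξ η
          + nfkB ξ (ξ - η)) := by
        gcongr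
        exact le_add_right le_add_self
      refine le_trans ?_ this
      unfold nfkB
      rw [if_pos ha, h36, ← ENNReal.ofReal_mul (by norm_num)]
      apply ENNReal.ofReal_le_ofReal
      calc _ = √(nfCross η ξ) * (‖ξ‖ ^ (s₁ + s₂ - 3) * ‖η‖ ^ (-s₁) * ‖ξ - η‖ ^ (-s₂)) := by ring
        _ ≤ √(nfCross η ξ) * (4 / (‖ξ‖ * ‖η‖ ^ 2)) := by gcongr
        _ = 4 * (√(nfCross η ξ) / (‖ξ‖ * ‖η‖ ^ 2)) := by ring
        _ ≤ _ := by gcongr; norm_num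
    by_cases hb : 2 * ‖ξ - η‖ ≤ ‖η‖
    · have key := nf_sc_a s₂ s₁ ‖ξ - η‖ ‖η‖ ‖ξ‖ hs₂ hs₁ (by linarith) hρ hR (by linarith)
        (by linarith)
      have : 36 * nfkB ξ (ξ - η) ≤ 36 * (ENNReal.ofReal (1 / √‖η‖ * (1 / √‖ξ - η‖)) + nfkB ξ η
          + nfkB ξ (ξ - η)) := by
        gcongr
        exact le_add_self
      refine le_trans ?_ this
      unfold nfkB
      rw [sub_sub_cancel, if_pos hb, nfCross_sub, h36, ← ENNReal.ofReal_mul (by norm_num)]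
      apply ENNReal.ofReal_le_ofReal
      rw [add_comm s₂ s₁] at key
      calc _ = √(nfCross η ξ) * (‖ξ‖ ^ (s₁ + s₂ - 3) * ‖ξ - η‖ ^ (-s₂) * ‖η‖ ^ (-s₁)) := by ring
        _ ≤ √(nfCross η ξ) * (4 / (‖ξ‖ * ‖ξ - η‖ ^ 2)) := by gcongr
        _ = 4 * (√(nfCross η ξ) / (‖ξ‖ * ‖ξ - η‖ ^ 2)) := by ring
        _ ≤ _ := by gcongr; norm_num
    · have key := nf_sc_c s₁ s₂ ‖η‖ ‖ξ - η‖ ‖ξ‖ hs₁ hs₂ hsum hr hρ hR (by linarith) (by linarith)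
        (by linarith)
      have : 36 * ENNReal.ofReal (1 / √‖η‖ * (1 / √‖ξ - η‖)) ≤
          36 * (ENNReal.ofReal (1 / √‖η‖ * (1 / √‖ξ - η‖)) + nfkB ξ η + nfkB ξ (ξ - η)) := by
        gcongr
        rw [add_assoc]
        exact le_self_add
      refine le_trans ?_ this
      rw [h36, ← ENNReal.ofReal_mul (by norm_num)]
      apply ENNReal.ofReal_le_ofReal
      refine le_trans ?_ key
      gcongr
      exact nfCross_le η ξ

end

open MeasureTheory
open scoped FourierTransform ENNReal
noncomputable section

lemma nf_kBm2 : Measurable fun p : EuclideanSpace ℝ (Fin 4) × EuclideanSpace ℝ (Fin 4) =>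
    nfkB (spacePart p.1) (spacePart p.2) := by
  have h3 := nf_spacePart_meas
  unfold nfkB nfCross
  refine Measurable.ite ?_ ?_ ?_
  · exact measurableSet_le (by fun_prop) (by fun_prop)
  · fun_prop
  · fun_prop

def nfCC (b : ℝ) : ℝ≥0∞ := 36 ^ 2 * (4 * (16 * nfCA b) + 4 * (4 * nfCB b) + 2 * (4 * nfCB b))

lemma nfCC_lt (b : ℝ) (hb : 1 / 2 < b) : nfCC b < ⊤ := by
  have h1 := nfCA_lt b hb
  have h2 := nfCB_lt b hb
  unfold nfCC
  finiteness

lemma nf_bilinear (b s₁ s₂ : ℝ) (hs₁ : s₁ ≤ 2) (hs₂ : s₂ ≤ 2) (hsum : 2 ≤ s₁ + s₂)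
    (i j : Fin 3) (f g : EuclideanSpace ℝ (Fin 4) → ℝ≥0∞)
    (hf : Measurable f) (hg : Measurable g) :
    ∫⁻ ζ, (∫⁻ ζ₁, ENNReal.ofReal (‖spacePart ζ‖ ^ (s₁ + s₂ - 3) *
        |spacePart ζ₁ i * (spacePart ζ - spacePart ζ₁) j
          - spacePart ζ₁ j * (spacePart ζ - spacePart ζ₁) i| *
      (1 + ‖spacePart ζ₁‖ ^ 2) ^ (-(s₁ / 2)) *
      (1 + ‖spacePart ζ - spacePart ζ₁‖ ^ 2) ^ (-(s₂ / 2))) *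
      (nfM b ζ₁ * nfM b (ζ - ζ₁) * (f ζ₁ * g (ζ - ζ₁)))) ^ 2 ≤
      nfCC b * ((∫⁻ ζ, f ζ ^ 2) * ∫⁻ ζ, g ζ ^ 2) := by
  have m1 := nfκ_meas
  have m2 := nfM_meas b
  have m3 := nf_spacePart_meas
  have m4 := nf_kBm2
  have TA := nf_TA b f g hf hg
  have TB := nf_TB b f g hf hg
  have TB' := nf_TB' b f g hf hg
  unfold nfN at TA
  set S := (∫⁻ ζ, f ζ ^ 2) * ∫⁻ ζ, g ζ ^ 2 with hS
  let A : EuclideanSpace ℝ (Fin 4) → EuclideanSpace ℝ (Fin 4) → ℝ≥0∞ := fun ζ ζ₁ =>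
    (nfκ ζ₁ * nfM b ζ₁ * f ζ₁) * (nfκ (ζ - ζ₁) * nfM b (ζ - ζ₁) * g (ζ - ζ₁))
  let B : EuclideanSpace ℝ (Fin 4) → EuclideanSpace ℝ (Fin 4) → ℝ≥0∞ := fun ζ ζ₁ =>
    nfkB (spacePart ζ) (spacePart ζ₁) * nfM b ζ₁ * nfM b (ζ - ζ₁) * (f ζ₁ * g (ζ - ζ₁))
  let D : EuclideanSpace ℝ (Fin 4) → EuclideanSpace ℝ (Fin 4) → ℝ≥0∞ := fun ζ ζ₁ =>
    nfkB (spacePart ζ) (spacePart (ζ - ζ₁)) * nfM b ζ₁ * nfM b (ζ - ζ₁) * (f ζ₁ * g (ζ - ζ₁))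
  have hA : Measurable fun p : EuclideanSpace ℝ (Fin 4) × EuclideanSpace ℝ (Fin 4) =>
      A p.1 p.2 := by simp only [A]; fun_prop
  have hB : Measurable fun p : EuclideanSpace ℝ (Fin 4) × EuclideanSpace ℝ (Fin 4) =>
      B p.1 p.2 := by simp only [B]; fun_prop
  change ∫⁻ ζ, (∫⁻ ζ₁, A ζ ζ₁) ^ 2 ≤ _ at TA
  change ∫⁻ ζ, (∫⁻ ζ₁, B ζ ζ₁) ^ 2 ≤ _ at TB
  change ∫⁻ ζ, (∫⁻ ζ₁, D ζ ζ₁) ^ 2 ≤ _ at TB'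
  have hpt : ∀ ζ ζ₁, ENNReal.ofReal (‖spacePart ζ‖ ^ (s₁ + s₂ - 3) *
        |spacePart ζ₁ i * (spacePart ζ - spacePart ζ₁) j
          - spacePart ζ₁ j * (spacePart ζ - spacePart ζ₁) i| *
      (1 + ‖spacePart ζ₁‖ ^ 2) ^ (-(s₁ / 2)) *
      (1 + ‖spacePart ζ - spacePart ζ₁‖ ^ 2) ^ (-(s₂ / 2))) *
      (nfM b ζ₁ * nfM b (ζ - ζ₁) * (f ζ₁ * g (ζ - ζ₁))) ≤ 36 * ((A ζ ζ₁ + B ζ ζ₁) + D ζ ζ₁) := by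
    intro ζ ζ₁
    refine (mul_le_mul_left (nf_pointwise s₁ s₂ hs₁ hs₂ hsum i j (spacePart ζ) (spacePart ζ₁))
      _).trans (le_of_eq ?_)
    simp only [A, B, D, nfκ, nf_spacePart_sub]
    ring
  clear_value A B D
  have hin : ∀ ζ, (∫⁻ ζ₁, ENNReal.ofReal (‖spacePart ζ‖ ^ (s₁ + s₂ - 3) *
        |spacePart ζ₁ i * (spacePart ζ - spacePart ζ₁) j
          - spacePart ζ₁ j * (spacePart ζ - spacePart ζ₁) i| *
      (1 + ‖spacePart ζ₁‖ ^ 2) ^ (-(s₁ / 2)) *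
      (1 + ‖spacePart ζ - spacePart ζ₁‖ ^ 2) ^ (-(s₂ / 2))) *
      (nfM b ζ₁ * nfM b (ζ - ζ₁) * (f ζ₁ * g (ζ - ζ₁)))) ^ 2 ≤
      36 ^ 2 * ((4 * (∫⁻ ζ₁, A ζ ζ₁) ^ 2 + 4 * (∫⁻ ζ₁, B ζ ζ₁) ^ 2)
        + 2 * (∫⁻ ζ₁, D ζ ζ₁) ^ 2) := by
    intro ζ
    have hAζ : Measurable (A ζ) := hA.comp (measurable_const.prodMk measurable_id)
    have hBζ : Measurable (B ζ) := hB.comp (measurable_const.prodMk measurable_id)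
    refine (pow_le_pow_left' (lintegral_mono (hpt ζ)) 2).trans ?_
    rw [lintegral_const_mul' _ _ (by simp), lintegral_add_left (by fun_prop),
      lintegral_add_left (by fun_prop), mul_pow]
    gcongr
    refine (nf_add_sq _ _).trans ?_
    have := nf_add_sq (∫⁻ ζ₁, A ζ ζ₁) (∫⁻ ζ₁, B ζ ζ₁)
    calc _ ≤ 2 * (2 * (∫⁻ ζ₁, A ζ ζ₁) ^ 2 + 2 * (∫⁻ ζ₁, B ζ ζ₁) ^ 2)
        + 2 * (∫⁻ ζ₁, D ζ ζ₁) ^ 2 := by gcongr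
      _ = _ := by ring
  refine (lintegral_mono hin).trans ?_
  have hA' : Measurable fun ζ => ∫⁻ ζ₁, A ζ ζ₁ := hA.lintegral_prod_right'
  have hB' : Measurable fun ζ => ∫⁻ ζ₁, B ζ ζ₁ := hB.lintegral_prod_right'
  rw [lintegral_const_mul' _ _ (by finiteness), lintegral_add_left (by fun_prop),
      lintegral_add_left (by fun_prop), lintegral_const_mul' _ _ (by simp),
      lintegral_const_mul' _ _ (by simp), lintegral_const_mul' _ _ (by simp)]
  calc _ ≤ 36 ^ 2 * (4 * (16 * nfCA b * S) + 4 * (4 * nfCB b * S) + 2 * (4 * nfCB b * S)) := by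
        gcongr
    _ = _ := by unfold nfCC; ring

end

open MeasureTheory
open scoped FourierTransform ENNReal
noncomputable section

open scoped SchwartzMap LineDeriv Convolution in
lemma nf_fourier_mul (f g : 𝓢(EuclideanSpace ℝ (Fin 4), ℂ)) (ζ : EuclideanSpace ℝ (Fin 4)) :
    𝓕 (SchwartzMap.pairing (ContinuousLinearMap.mul ℂ ℂ) f g) ζ =
      ∫ ζ₁, 𝓕 f ζ₁ * 𝓕 g (ζ - ζ₁) := by
  have h1 : 𝓕⁻ (SchwartzMap.convolution (ContinuousLinearMap.mul ℂ ℂ) (𝓕 f) (𝓕 g)) =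
      SchwartzMap.pairing (ContinuousLinearMap.mul ℂ ℂ) f g := by
    ext x
    have hinv : ∀ h : 𝓢(EuclideanSpace ℝ (Fin 4), ℂ), 𝓕⁻ h x = 𝓕 h (-x) := by
      intro h
      rw [SchwartzMap.fourierInv_apply_eq]
      simp
    rw [hinv, SchwartzMap.fourier_convolution]
    simp only [SchwartzMap.pairing_apply_apply]
    rw [← hinv, ← hinv, FourierTransform.fourierInv_fourier_eq,
      FourierTransform.fourierInv_fourier_eq]
  rw [← h1, FourierTransform.fourier_fourierInv_eq, SchwartzMap.convolution_apply]
  simp [convolution]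

open scoped SchwartzMap LineDeriv in
/-- The null form as a Schwartz function. -/
def nfQ (i j : Fin 3) (u v : 𝓢(EuclideanSpace ℝ (Fin 4), ℂ)) : 𝓢(EuclideanSpace ℝ (Fin 4), ℂ) :=
  SchwartzMap.pairing (ContinuousLinearMap.mul ℂ ℂ)
    (∂_{(EuclideanSpace.single i.succ 1 : EuclideanSpace ℝ (Fin 4))} u)
    (∂_{(EuclideanSpace.single j.succ 1 : EuclideanSpace ℝ (Fin 4))} v) -
  SchwartzMap.pairing (ContinuousLinearMap.mul ℂ ℂ)
    (∂_{(EuclideanSpace.single j.succ 1 : EuclideanSpace ℝ (Fin 4))} u)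
    (∂_{(EuclideanSpace.single i.succ 1 : EuclideanSpace ℝ (Fin 4))} v)

open scoped SchwartzMap LineDeriv in
lemma nfQ_coe (i j : Fin 3) (u v : 𝓢(EuclideanSpace ℝ (Fin 4), ℂ)) :
    nullFormQij i j u v = nfQ i j u v := by
  ext z
  simp [nullFormQij, nfQ, pderiv, SchwartzMap.lineDerivOp_apply_eq_fderiv]

open scoped SchwartzMap LineDeriv in
lemma nf_fourier_deriv (i : Fin 3) (u : 𝓢(EuclideanSpace ℝ (Fin 4), ℂ))
    (ζ : EuclideanSpace ℝ (Fin 4)) :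
    𝓕 (∂_{(EuclideanSpace.single i.succ 1 : EuclideanSpace ℝ (Fin 4))} u) ζ =
      (2 * Real.pi * Complex.I) * (spacePart ζ i * 𝓕 u ζ) := by
  rw [SchwartzMap.fourier_lineDerivOp_eq]
  have : (fun x : EuclideanSpace ℝ (Fin 4) =>
    inner ℝ x (EuclideanSpace.single i.succ (1 : ℝ))).HasTemperateGrowth :=
      ((innerSL ℝ).flip _).hasTemperateGrowth
  rw [smul_apply, SchwartzMap.smulLeftCLM_apply_apply this]
  simp [spacePart, EuclideanSpace.inner_single_right]

open scoped SchwartzMap in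
lemma nf_prod_integrable (f g : 𝓢(EuclideanSpace ℝ (Fin 4), ℂ)) (ζ : EuclideanSpace ℝ (Fin 4)) :
    Integrable fun ζ₁ => f ζ₁ * g (ζ - ζ₁) := by
  refine f.integrable.mul_bdd (c := SchwartzMap.seminorm ℝ 0 0 g) ?_ ?_
  · exact (g.continuous.comp (by fun_prop)).aestronglyMeasurable
  · filter_upwards with x using SchwartzMap.norm_le_seminorm ℝ g _

open scoped SchwartzMap LineDeriv in
lemma nfQ_fourier (i j : Fin 3) (u v : 𝓢(EuclideanSpace ℝ (Fin 4), ℂ))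
    (ζ : EuclideanSpace ℝ (Fin 4)) :
    𝓕 (nfQ i j u v) ζ = ∫ ζ₁, (2 * Real.pi * Complex.I) ^ 2 *
      ((spacePart ζ₁ i * (spacePart ζ - spacePart ζ₁) j
          - spacePart ζ₁ j * (spacePart ζ - spacePart ζ₁) i : ℝ) : ℂ) *
        (𝓕 u ζ₁ * 𝓕 v (ζ - ζ₁)) := by
  have hs : ∀ a b : 𝓢(EuclideanSpace ℝ (Fin 4), ℂ), 𝓕 (a - b) = 𝓕 a - 𝓕 b := fun a b =>
    map_sub (FourierTransform.fourierCLM ℂ 𝓢(EuclideanSpace ℝ (Fin 4), ℂ)) a b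
  unfold nfQ
  rw [hs, sub_apply, nf_fourier_mul, nf_fourier_mul,
    ← integral_sub (nf_prod_integrable _ _ _) (nf_prod_integrable _ _ _)]
  refine integral_congr_ae (Filter.Eventually.of_forall fun ζ₁ => ?_)
  simp only [nf_fourier_deriv, nf_spacePart_sub]
  push_cast
  ring

open scoped SchwartzMap LineDeriv in
lemma nfQ_bound (i j : Fin 3) (u v : 𝓢(EuclideanSpace ℝ (Fin 4), ℂ))
    (ζ : EuclideanSpace ℝ (Fin 4)) :
    ‖𝓕 (nfQ i j u v) ζ‖ₑ ≤ ENNReal.ofReal (4 * Real.pi ^ 2) * ∫⁻ ζ₁,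
      ENNReal.ofReal |spacePart ζ₁ i * (spacePart ζ - spacePart ζ₁) j
          - spacePart ζ₁ j * (spacePart ζ - spacePart ζ₁) i| *
        (‖𝓕 u ζ₁‖ₑ * ‖𝓕 v (ζ - ζ₁)‖ₑ) := by
  rw [nfQ_fourier, ← lintegral_const_mul' _ _ ENNReal.ofReal_ne_top]
  refine (enorm_integral_le_lintegral_enorm _).trans (lintegral_mono fun ζ₁ => le_of_eq ?_)
  rw [enorm_mul, enorm_mul, enorm_mul, mul_assoc]
  congr 1
  · rw [← ofReal_norm]
    congr 1
    simp [abs_of_pos Real.pi_pos]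
    ring
  · congr 1
    rw [← ofReal_norm, Complex.norm_real, Real.norm_eq_abs]

end

open MeasureTheory
open scoped FourierTransform ENNReal
noncomputable section

open scoped SchwartzMap in
def nfW (s b : ℝ) (u : 𝓢(EuclideanSpace ℝ (Fin 4), ℂ)) (ζ : EuclideanSpace ℝ (Fin 4)) : ℝ≥0∞ :=
  ENNReal.ofReal ((1 + ‖spacePart ζ‖ ^ 2) ^ (s / 2) *
    (1 + (|ζ 0| - ‖spacePart ζ‖) ^ 2) ^ (b / 2)) * ‖𝓕 u ζ‖ₑ

open scoped SchwartzMap in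
lemma nfW_meas (s b : ℝ) (u : 𝓢(EuclideanSpace ℝ (Fin 4), ℂ)) : Measurable (nfW s b u) := by
  have h := nf_spacePart_meas
  have h2 : Measurable fun ζ => 𝓕 u ζ := (𝓕 u).continuous.measurable
  unfold nfW
  fun_prop

open scoped SchwartzMap in
lemma nfW_eq (s b : ℝ) (u : 𝓢(EuclideanSpace ℝ (Fin 4), ℂ)) (ζ : EuclideanSpace ℝ (Fin 4)) :
    ‖𝓕 u ζ‖ₑ = ENNReal.ofReal ((1 + ‖spacePart ζ‖ ^ 2) ^ (-(s / 2))) * (nfM b ζ * nfW s b u ζ) := by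
  unfold nfM nfW
  rw [← mul_assoc, ← mul_assoc, ← ENNReal.ofReal_mul (by positivity),
    ← ENNReal.ofReal_mul (by positivity)]
  rw [Real.rpow_neg (by positivity), Real.rpow_neg (by positivity)]
  have h1 : (1 + ‖spacePart ζ‖ ^ 2) ^ (s / 2) ≠ 0 := by positivity
  have h2 : (1 + (|ζ 0| - ‖spacePart ζ‖) ^ 2) ^ (b / 2) ≠ 0 := by positivity
  have : ((1 + ‖spacePart ζ‖ ^ 2) ^ (s / 2))⁻¹ * ((1 + (|ζ 0| - ‖spacePart ζ‖) ^ 2) ^ (b / 2))⁻¹ *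
      ((1 + ‖spacePart ζ‖ ^ 2) ^ (s / 2) * (1 + (|ζ 0| - ‖spacePart ζ‖) ^ 2) ^ (b / 2)) = 1 := by
    field_simp
  rw [this]; simp

open scoped SchwartzMap in
lemma nf_freq (b s₁ s₂ : ℝ) (hs₁ : s₁ ≤ 2) (hs₂ : s₂ ≤ 2) (hsum : 2 ≤ s₁ + s₂)
    (i j : Fin 3) (u v : 𝓢(EuclideanSpace ℝ (Fin 4), ℂ)) :
    ∫⁻ ζ, ENNReal.ofReal (‖spacePart ζ‖ ^ (2 * (s₁ + s₂ - 3))) * ‖𝓕 (nfQ i j u v) ζ‖ₑ ^ 2 ≤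
      ENNReal.ofReal (4 * Real.pi ^ 2) ^ 2 * nfCC b *
        ((∫⁻ ζ, nfW s₁ b u ζ ^ 2) * ∫⁻ ζ, nfW s₂ b v ζ ^ 2) := by
  have key := nf_bilinear b s₁ s₂ hs₁ hs₂ hsum i j (nfW s₁ b u) (nfW s₂ b v) (nfW_meas _ _ _)
    (nfW_meas _ _ _)
  rw [mul_assoc]
  refine le_trans ?_ (mul_le_mul_right key _)
  rw [← lintegral_const_mul' _ _ (by finiteness)]
  refine lintegral_mono fun ζ => ?_
  have e : ENNReal.ofReal (‖spacePart ζ‖ ^ (2 * (s₁ + s₂ - 3))) =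
      ENNReal.ofReal (‖spacePart ζ‖ ^ (s₁ + s₂ - 3)) ^ 2 := by
    rw [← ENNReal.ofReal_pow (by positivity), ← Real.rpow_mul_natCast (norm_nonneg _)]
    congr 2
    push_cast; ring
  rw [e, ← mul_pow, ← mul_pow]
  refine pow_le_pow_left' ?_ 2
  refine (mul_le_mul_right (nfQ_bound i j u v ζ) _).trans (le_of_eq ?_)
  rw [← mul_assoc, mul_comm (ENNReal.ofReal _), mul_assoc]
  congr 1
  rw [← lintegral_const_mul' _ _ ENNReal.ofReal_ne_top]
  refine lintegral_congr fun ζ₁ => ?_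
  rw [nfW_eq s₁ b u, nfW_eq s₂ b v, nf_spacePart_sub, ENNReal.ofReal_mul (by positivity),
    ENNReal.ofReal_mul (by positivity), ENNReal.ofReal_mul (by positivity)]
  ring

end

open MeasureTheory
open scoped FourierTransform ENNReal
noncomputable section

lemma nf_spacePart_cont : Continuous spacePart := by
  unfold spacePart
  refine (PiLp.continuous_toLp 2 _).comp ?_
  fun_prop

lemma nf_norm_split (ζ : EuclideanSpace ℝ (Fin 4)) : ‖ζ‖ ^ 2 = (ζ 0) ^ 2 + ‖spacePart ζ‖ ^ 2 := by
  rw [EuclideanSpace.norm_sq_eq, EuclideanSpace.norm_sq_eq, Fin.sum_univ_succ]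
  simp [spacePart]

lemma nf_rpow_le (x y s : ℝ) (n : ℕ) (hx : 1 ≤ x) (hxy : x ≤ y) (hs : s ≤ n) : x ^ s ≤ y ^ n := by
  calc x ^ s ≤ x ^ (n : ℝ) := Real.rpow_le_rpow_of_exponent_le hx hs
    _ = x ^ n := Real.rpow_natCast _ _
    _ ≤ y ^ n := by gcongr

open scoped SchwartzMap in
lemma nf_W_integrable (s b : ℝ) (u : 𝓢(EuclideanSpace ℝ (Fin 4), ℂ)) :
    Integrable fun ζ : EuclideanSpace ℝ (Fin 4) =>
      (1 + ‖spacePart ζ‖ ^ 2) ^ s * (1 + (|ζ 0| - ‖spacePart ζ‖) ^ 2) ^ b * ‖𝓕 u ζ‖ ^ 2 := by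
  obtain ⟨n, hn⟩ := exists_nat_ge s
  obtain ⟨m, hm⟩ := exists_nat_ge b
  set K := SchwartzMap.seminorm ℝ 0 0 (𝓕 u)
  have hK : ∀ ζ, ‖𝓕 u ζ‖ ≤ K := SchwartzMap.norm_le_seminorm ℝ (𝓕 u)
  have hIb : Integrable fun ζ : EuclideanSpace ℝ (Fin 4) =>
      2 ^ (n + m - 1) * K * (‖𝓕 u ζ‖ + ‖ζ‖ ^ (2 * (n + m)) * ‖𝓕 u ζ‖) :=
    (((𝓕 u).integrable.norm).add ((𝓕 u).integrable_pow_mul volume _)).const_mul _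
  refine hIb.mono' ?_ ?_
  · have := nf_spacePart_meas
    have h2 : Measurable fun ζ => 𝓕 u ζ := (𝓕 u).continuous.measurable
    exact Measurable.aestronglyMeasurable (by fun_prop)
  · filter_upwards with ζ
    have hsp := nf_norm_split ζ
    have h0 := sq_nonneg (ζ 0)
    have h0' := sq_abs (ζ 0)
    have h1 : (1 + ‖spacePart ζ‖ ^ 2) ^ s ≤ (1 + ‖ζ‖ ^ 2) ^ n :=
      nf_rpow_le _ _ _ _ (by nlinarith [sq_nonneg ‖spacePart ζ‖]) (by nlinarith) hn
    have h2 : (1 + (|ζ 0| - ‖spacePart ζ‖) ^ 2) ^ b ≤ (1 + ‖ζ‖ ^ 2) ^ m :=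
      nf_rpow_le _ _ _ _ (by nlinarith [sq_nonneg (|ζ 0| - ‖spacePart ζ‖)])
        (by nlinarith [mul_nonneg (abs_nonneg (ζ 0)) (norm_nonneg (spacePart ζ))]) hm
    rw [Real.norm_of_nonneg (by positivity)]
    have h3 : (1 + ‖ζ‖ ^ 2) ^ (n + m) ≤ 2 ^ (n + m - 1) * (1 ^ (n + m) + (‖ζ‖ ^ 2) ^ (n + m)) :=
      add_pow_le (by norm_num) (by positivity) _
    rw [one_pow, ← pow_mul] at h3
    calc _ ≤ (1 + ‖ζ‖ ^ 2) ^ n * (1 + ‖ζ‖ ^ 2) ^ m * (K * ‖𝓕 u ζ‖) := by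
          gcongr
          rw [sq]
          gcongr
          exact hK ζ
      _ = (1 + ‖ζ‖ ^ 2) ^ (n + m) * (K * ‖𝓕 u ζ‖) := by rw [pow_add]
      _ ≤ 2 ^ (n + m - 1) * (1 + ‖ζ‖ ^ (2 * (n + m))) * (K * ‖𝓕 u ζ‖) := by
          have : 0 ≤ K := (norm_nonneg _).trans (hK ζ)
          gcongr
      _ = _ := by ring

open scoped SchwartzMap in
lemma nf_W_norm (s b : ℝ) (u : 𝓢(EuclideanSpace ℝ (Fin 4), ℂ)) :
    ∫⁻ ζ, nfW s b u ζ ^ 2 = ENNReal.ofReal (waveSobolevNorm s b u ^ 2) := by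
  unfold waveSobolevNorm
  rw [← Real.sqrt_eq_rpow, Real.sq_sqrt (integral_nonneg fun ζ => by positivity)]
  have hi := nf_W_integrable s b u
  rw [← SchwartzMap.fourier_coe, ofReal_integral_eq_lintegral_ofReal hi
    (Filter.Eventually.of_forall fun ζ => by positivity)]
  refine lintegral_congr fun ζ => ?_
  unfold nfW
  rw [← ofReal_norm, ← ENNReal.ofReal_mul (by positivity), ← ENNReal.ofReal_pow (by positivity)]
  congr 1
  rw [mul_pow, mul_pow, ← Real.rpow_mul_natCast (by positivity),
    ← Real.rpow_mul_natCast (by positivity)]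
  norm_num

end

open MeasureTheory
open scoped FourierTransform ENNReal
noncomputable section

lemma nf_ofReal_integral {α : Type*} [MeasurableSpace α] (μ : Measure α) (f : α → ℝ)
    (hf : ∀ x, 0 ≤ f x) : ENNReal.ofReal (∫ x, f x ∂μ) ≤ ∫⁻ x, ENNReal.ofReal (f x) ∂μ := by
  by_cases h : Integrable f μ
  · rw [ofReal_integral_eq_lintegral_ofReal h (Filter.Eventually.of_forall hf)]
  · rw [integral_undef h]; simp

lemma nfJoin_inner (t τ : ℝ) (x ξ : EuclideanSpace ℝ (Fin 3)) :
    inner ℝ (nfJoin t x) (nfJoin τ ξ) = t * τ + inner ℝ x ξ := by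
  simp [nfJoin, PiLp.inner_apply, Fin.sum_univ_succ]
  ring

lemma nfJoin_cont : Continuous fun p : ℝ × EuclideanSpace ℝ (Fin 3) => nfJoin p.1 p.2 := by
  unfold nfJoin
  refine (PiLp.continuous_toLp 2 _).comp ?_
  refine continuous_pi fun i => ?_
  refine Fin.cases ?_ (fun i => ?_) i
  · simp; fun_prop
  · simp; fun_prop

lemma nfJoin_norm (t : ℝ) (x : EuclideanSpace ℝ (Fin 3)) : ‖nfJoin t x‖ ^ 2 = t ^ 2 + ‖x‖ ^ 2 := by
  rw [nf_norm_split, nfJoin_zero, nfJoin_space]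

lemma nfJoin_norm_ge (t : ℝ) (x : EuclideanSpace ℝ (Fin 3)) : ‖x‖ ≤ ‖nfJoin t x‖ := by
  have := nfJoin_norm t x
  exact abs_le_of_sq_le_sq' (by nlinarith [sq_nonneg t]) (norm_nonneg _) |>.2

lemma nfJoin_norm_ge' (t : ℝ) (x : EuclideanSpace ℝ (Fin 3)) : ‖t‖ ≤ ‖nfJoin t x‖ := by
  have := nfJoin_norm t x
  refine abs_le_of_sq_le_sq' ?_ (norm_nonneg _) |>.2
  rw [Real.norm_eq_abs, sq_abs]
  nlinarith [sq_nonneg ‖x‖]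

lemma nfJoin_affine (t : ℝ) (x : EuclideanSpace ℝ (Fin 3)) :
    nfJoin t x = t • nfJoin 1 0 + nfJoin 0 x := by
  ext i
  refine Fin.cases ?_ (fun i => ?_) i <;> simp [nfJoin]

lemma nfJoin_temperate (ξ : EuclideanSpace ℝ (Fin 3)) :
    (fun τ : ℝ => nfJoin τ ξ).HasTemperateGrowth := by
  have : (fun τ : ℝ => nfJoin τ ξ) = fun τ : ℝ =>
      ((ContinuousLinearMap.id ℝ ℝ).smulRight (nfJoin 1 0)) τ + nfJoin 0 ξ := by
    ext1 τ
    rw [nfJoin_affine]; simp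
  rw [this]
  exact (ContinuousLinearMap.hasTemperateGrowth _).add (Function.HasTemperateGrowth.const _)

open scoped SchwartzMap in
def nfH (h : 𝓢(EuclideanSpace ℝ (Fin 4), ℂ)) (ξ : EuclideanSpace ℝ (Fin 3)) : 𝓢(ℝ, ℂ) :=
  SchwartzMap.compCLM ℂ (nfJoin_temperate ξ)
    ⟨1, 1, fun τ => by have := nfJoin_norm_ge' τ ξ; linarith⟩ h

open scoped SchwartzMap in
lemma nfH_apply (h : 𝓢(EuclideanSpace ℝ (Fin 4), ℂ)) (ξ : EuclideanSpace ℝ (Fin 3)) (τ : ℝ) :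
    nfH h ξ τ = h (nfJoin τ ξ) := rfl

open scoped SchwartzMap in
lemma nf_plancherel_lintegral (h : 𝓢(ℝ, ℂ)) : ∫⁻ t, ‖𝓕⁻ h t‖ₑ ^ 2 = ∫⁻ t, ‖h t‖ₑ ^ 2 := by
  have e : ∀ k : 𝓢(ℝ, ℂ), ∫⁻ t, ‖k t‖ₑ ^ 2 = ENNReal.ofReal (∫ t, ‖k t‖ ^ 2) := by
    intro k
    have hi : Integrable (fun t => ‖k t‖ ^ 2) := (k.memLp 2).integrable_norm_pow (by norm_num)
    rw [ofReal_integral_eq_lintegral_ofReal hi (Filter.Eventually.of_forall fun ζ => by positivity)]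
    refine lintegral_congr fun t => ?_
    rw [ENNReal.ofReal_pow (norm_nonneg _), ofReal_norm]
  rw [e, e, ← SchwartzMap.integral_norm_sq_fourier (𝓕⁻ h), FourierTransform.fourier_fourierInv_eq]

open scoped SchwartzMap in
def nfG (Q : 𝓢(EuclideanSpace ℝ (Fin 4), ℂ)) (t : ℝ) (ξ : EuclideanSpace ℝ (Fin 3)) : ℂ :=
  ∫ x : EuclideanSpace ℝ (Fin 3), Real.fourierChar (-inner ℝ x ξ) • Q (nfJoin t x)

open scoped SchwartzMap in
lemma nfG_eq (Q : 𝓢(EuclideanSpace ℝ (Fin 4), ℂ)) (t : ℝ) (ξ : EuclideanSpace ℝ (Fin 3)) :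
    𝓕 (timeSlice Q t) ξ = nfG Q t ξ := rfl

open scoped SchwartzMap in
lemma nfG_meas (Q : 𝓢(EuclideanSpace ℝ (Fin 4), ℂ)) :
    StronglyMeasurable fun p : ℝ × EuclideanSpace ℝ (Fin 3) => nfG Q p.1 p.2 := by
  unfold nfG
  refine StronglyMeasurable.integral_prod_right (f := fun (p : ℝ × EuclideanSpace ℝ (Fin 3))
    (x : EuclideanSpace ℝ (Fin 3)) => Real.fourierChar (-inner ℝ x p.2) • Q (nfJoin p.1 x)) ?_
  have h1 := Q.continuous
  have h2 := nfJoin_cont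
  have h3 := Real.continuous_fourierChar
  refine Continuous.stronglyMeasurable ?_
  have hc : Continuous fun q : (ℝ × EuclideanSpace ℝ (Fin 3)) × EuclideanSpace ℝ (Fin 3) =>
    Real.fourierChar (-inner ℝ q.2 q.1.2) := h3.comp (by fun_prop)
  refine Continuous.smul (continuous_subtype_val.comp hc) ?_
  exact h1.comp (h2.comp (f := fun q : (ℝ × EuclideanSpace ℝ (Fin 3)) × EuclideanSpace ℝ (Fin 3) =>
    (q.1.1, q.2)) (by fun_prop))

open scoped SchwartzMap in
lemma nfG_prod_integrable (Q : 𝓢(EuclideanSpace ℝ (Fin 4), ℂ)) :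
    Integrable (fun p : ℝ × EuclideanSpace ℝ (Fin 3) => Q (nfJoin p.1 p.2))
      ((volume : Measure ℝ).prod volume) := by
  have := nfJoin_mp.integrable_comp (g := Q) Q.continuous.aestronglyMeasurable
  exact this.2 Q.integrable

open scoped SchwartzMap in
lemma nfG_cont (Q : 𝓢(EuclideanSpace ℝ (Fin 4), ℂ)) (ξ : EuclideanSpace ℝ (Fin 3)) :
    Continuous fun t => nfG Q t ξ := by
  have h1 := Q.continuous
  have h2 := nfJoin_cont
  have h3 := Real.continuous_fourierChar
  set K := 2 ^ 4 * (Finset.Iic ((4, 0) : ℕ × ℕ)).sup (fun m => SchwartzMap.seminorm ℝ m.1 m.2) Q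
  have hK : ∀ ζ, (1 + ‖ζ‖) ^ 4 * ‖Q ζ‖ ≤ K := by
    intro ζ
    simpa using SchwartzMap.one_add_le_sup_seminorm_apply (𝕜 := ℝ) (m := (4, 0)) (k := 4) (n := 0)
      le_rfl le_rfl Q ζ
  unfold nfG
  refine continuous_of_dominated (bound := fun x => K * (1 + ‖x‖) ^ (-(4 : ℝ))) ?_ ?_ ?_ ?_
  · intro t
    refine Continuous.aestronglyMeasurable ?_
    have hc : Continuous fun x : EuclideanSpace ℝ (Fin 3) =>
      Real.fourierChar (-inner ℝ x ξ) := h3.comp (by fun_prop)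
    exact Continuous.smul (continuous_subtype_val.comp hc) (h1.comp (h2.comp (by fun_prop : Continuous
      fun x : EuclideanSpace ℝ (Fin 3) => (t, x))))
  · intro t
    filter_upwards with x
    rw [Circle.norm_smul, Real.rpow_neg (by positivity), ← div_eq_mul_inv,
      le_div_iff₀ (by positivity), mul_comm]
    refine le_trans ?_ (hK (nfJoin t x))
    have := nfJoin_norm_ge t x
    have e : (1 + ‖x‖) ^ (4 : ℝ) = (1 + ‖x‖) ^ 4 := by norm_cast
    rw [e]
    gcongr
  · refine (integrable_one_add_norm ?_).const_mul K
    simp; norm_num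
  · filter_upwards with x
    exact continuous_const.smul (h1.comp (h2.comp (by fun_prop : Continuous
      fun t : ℝ => (t, x))))

open scoped SchwartzMap in
lemma nfG_integrable' (Q : 𝓢(EuclideanSpace ℝ (Fin 4), ℂ)) (ξ : EuclideanSpace ℝ (Fin 3)) (τ : ℝ) :
    Integrable (fun p : ℝ × EuclideanSpace ℝ (Fin 3) =>
      Real.fourierChar (-(p.1 * τ + inner ℝ p.2 ξ)) • Q (nfJoin p.1 p.2))
      ((volume : Measure ℝ).prod volume) := by
  have h3 := Real.continuous_fourierChar
  refine (nfG_prod_integrable Q).mono ?_ ?_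
  · exact (h3.comp (by fun_prop)).aestronglyMeasurable.smul
      (nfG_prod_integrable Q).aestronglyMeasurable
  · filter_upwards with p using by simp

open scoped SchwartzMap in
lemma nfG_fourier (Q : 𝓢(EuclideanSpace ℝ (Fin 4), ℂ)) (ξ : EuclideanSpace ℝ (Fin 3)) (τ : ℝ) :
    𝓕 (fun t => nfG Q t ξ) τ = 𝓕 Q (nfJoin τ ξ) := by
  rw [SchwartzMap.fourier_coe, Real.fourier_eq, Real.fourier_eq]
  have hm : ∫ ζ, Real.fourierChar (-inner ℝ ζ (nfJoin τ ξ)) • Q ζ =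
      ∫ p : ℝ × EuclideanSpace ℝ (Fin 3),
        Real.fourierChar (-inner ℝ (nfJoin p.1 p.2) (nfJoin τ ξ)) • Q (nfJoin p.1 p.2) := by
    conv_lhs => rw [← nfJoin_mp.map_eq]
    rw [integral_map nfJoin_mp.measurable.aemeasurable]
    refine Continuous.aestronglyMeasurable ?_
    have hc : Continuous fun ζ : EuclideanSpace ℝ (Fin 4) =>
      Real.fourierChar (-inner ℝ ζ (nfJoin τ ξ)) := Real.continuous_fourierChar.comp (by fun_prop)
    exact Continuous.smul (continuous_subtype_val.comp hc) Q.continuous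
  rw [hm]
  simp only [nfJoin_inner]
  rw [Measure.volume_eq_prod, integral_prod _ (nfG_integrable' Q ξ τ)]
  refine integral_congr_ae (Filter.Eventually.of_forall fun t => ?_)
  simp only [nfG]
  rw [Circle.smul_def, ← integral_smul]
  refine integral_congr_ae (Filter.Eventually.of_forall fun x => ?_)
  simp only [← Circle.smul_def]
  rw [smul_smul, ← AddChar.map_add_eq_mul]
  congr 2
  simp
  ring

open scoped SchwartzMap in
lemma nfG_inv (Q : 𝓢(EuclideanSpace ℝ (Fin 4), ℂ)) (ξ : EuclideanSpace ℝ (Fin 3)) (t : ℝ) :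
    nfG Q t ξ = 𝓕⁻ (nfH (𝓕 Q) ξ) t := by
  have hF : 𝓕 (fun t => nfG Q t ξ) = nfH (𝓕 Q) ξ := by
    ext τ; rw [nfG_fourier, nfH_apply]
  have hi : Integrable fun t => nfG Q t ξ := by
    have := (nfG_integrable' Q ξ 0).integral_prod_left
    simpa [nfG] using this
  have := (nfG_cont Q ξ).fourierInv_fourier_eq hi (by rw [hF]; exact (nfH (𝓕 Q) ξ).integrable)
  rw [hF] at this
  rw [SchwartzMap.fourierInv_coe, this]

open scoped SchwartzMap in
lemma nf_lhs (σ : ℝ) (Q : 𝓢(EuclideanSpace ℝ (Fin 4), ℂ)) :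
    ENNReal.ofReal (mixedL2HomNorm σ Q ^ 2) ≤
      ∫⁻ ζ, ENNReal.ofReal (‖spacePart ζ‖ ^ (2 * σ)) * ‖𝓕 Q ζ‖ₑ ^ 2 := by
  have hm := nfG_meas Q
  have hsp := nf_spacePart_meas
  have hQm : Measurable fun ζ => 𝓕 Q ζ := (𝓕 Q).continuous.measurable
  unfold mixedL2HomNorm
  rw [← Real.sqrt_eq_rpow, Real.sq_sqrt (integral_nonneg fun ζ => by positivity)]
  refine (nf_ofReal_integral _ _ fun t => by positivity).trans ?_
  rw [nf_fin4 _ (by fun_prop)]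
  calc _ ≤ ∫⁻ t, ∫⁻ ξ, ENNReal.ofReal (‖ξ‖ ^ (2 * σ)) * ‖nfG Q t ξ‖ₑ ^ 2 := by
        refine lintegral_mono fun t => ?_
        unfold homSobolevNorm3
        rw [← Real.sqrt_eq_rpow, Real.sq_sqrt (integral_nonneg fun ζ => by positivity)]
        refine (nf_ofReal_integral _ _ fun ξ => by positivity).trans (le_of_eq ?_)
        refine lintegral_congr fun ξ => ?_
        rw [ENNReal.ofReal_mul (by positivity), ENNReal.ofReal_pow (by positivity), nfG_eq,
          ofReal_norm]
    _ = ∫⁻ ξ, ∫⁻ t, ENNReal.ofReal (‖ξ‖ ^ (2 * σ)) * ‖nfG Q t ξ‖ₑ ^ 2 := by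
        refine lintegral_lintegral_swap ?_
        have hm' := hm.measurable
        refine Measurable.aemeasurable ?_
        change Measurable fun p : ℝ × EuclideanSpace ℝ (Fin 3) =>
          ENNReal.ofReal (‖p.2‖ ^ (2 * σ)) * ‖nfG Q p.1 p.2‖ₑ ^ 2
        fun_prop
    _ ≤ _ := by
        refine lintegral_mono fun ξ => le_of_eq ?_
        simp only [nfJoin_space]
        rw [lintegral_const_mul' _ _ ENNReal.ofReal_ne_top,
          lintegral_const_mul' _ _ ENNReal.ofReal_ne_top]
        congr 1
        simp only [nfG_inv]
        rw [nf_plancherel_lintegral]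
        rfl

end

/-- Null form estimate for `Q_{ij}` (Masmoudi–Nakanishi, Foschi–Klainerman). -/
theorem nullFormQij_estimate (b : ℝ) (hb : 1 / 2 < b) (s₁ s₂ : ℝ)
    (hs₁ : s₁ ≤ 2) (hs₂ : s₂ ≤ 2) (hsum : 2 ≤ s₁ + s₂) :
    ∃ C > (0 : ℝ), ∀ (i j : Fin 3) (u v : SchwartzMap (EuclideanSpace ℝ (Fin 4)) ℂ),
      mixedL2HomNorm (s₁ + s₂ - 3) (nullFormQij i j (⇑u) (⇑v)) ≤
        C * waveSobolevNorm s₁ b (⇑u) * waveSobolevNorm s₂ b (⇑v) := by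
  set K := ENNReal.ofReal (4 * Real.pi ^ 2) ^ 2 * nfCC b with hK
  have hKt : K ≠ ⊤ := (ENNReal.mul_lt_top (by finiteness) (nfCC_lt b hb)).ne
  refine ⟨√(K.toReal) + 1, by positivity, fun i j u v => ?_⟩
  rw [nfQ_coe]
  have h := (nf_lhs (s₁ + s₂ - 3) (nfQ i j u v)).trans (nf_freq b s₁ s₂ hs₁ hs₂ hsum i j u v)
  rw [nf_W_norm, nf_W_norm, ← hK, ← ENNReal.ofReal_toReal hKt, ← ENNReal.ofReal_mul (by positivity),
    ← ENNReal.ofReal_mul (by positivity)] at h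
  have h' := (ENNReal.ofReal_le_ofReal_iff (by positivity)).1 h
  have nu : ∀ s (w : SchwartzMap (EuclideanSpace ℝ (Fin 4)) ℂ), 0 ≤ waveSobolevNorm s b w := by
    intro s w
    unfold waveSobolevNorm
    exact Real.rpow_nonneg (integral_nonneg fun ζ => by positivity) _
  have n1 := nu s₁ u
  have n2 := nu s₂ v
  have h3 : mixedL2HomNorm (s₁ + s₂ - 3) (nfQ i j u v) ≤
      √(K.toReal) * (waveSobolevNorm s₁ b u * waveSobolevNorm s₂ b v) := by
    refine le_trans (le_abs_self _) (abs_le_of_sq_le_sq ?_ (by positivity))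
    rw [mul_pow, Real.sq_sqrt ENNReal.toReal_nonneg, mul_pow]
    exact h'
  refine h3.trans ?_
  rw [mul_assoc]
  gcongr
  linarith
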